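/- arXiv:2510.10668 — 10 statements merged into one kernel-verified Lean document; each statement's English description precedes it below -/
import Mathlib

section
/- For all integers i, j ≥ 0 with i ≠ j and |i - j| ≠ 2, the M-functions are L²-orthogonal on [-1,1]: ∫_{-1}^{1} M̂_i(x) M̂_j(x) dx = 0. -/
/-- The M-functions on `[-1,1]`: `M̂_0 = 1`, `M̂_1 = x`, and for `i ≥ 1`,
`M̂_{i+1}(x) = (1/(2^i i!)) dⁱ⁻¹/dxⁱ⁻¹ (x²-1)ⁱ`. -/
noncomputable def Mhat : ℕ → ℝ → ℝ
  | 0 => fun _ => 1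
  | 1 => fun x => x
  | (i + 2) => fun x =>
      (1 / ((2 : ℝ) ^ (i + 1) * (Nat.factorial (i + 1) : ℝ))) *
        iteratedDeriv i (fun y => (y ^ 2 - 1) ^ (i + 1)) x

open Polynomial in
theorem iteratedDeriv_poly_eval (n : ℕ) (p : ℝ[X]) :
    iteratedDeriv n (fun x => p.eval x) = fun x => (derivative^[n] p).eval x := by
  induction n generalizing p with
  | zero => simp
  | succ n ih =>
    rw [iteratedDeriv_succ']
    have h : deriv (fun x => p.eval x) = fun x => (derivative p).eval x := by
      funext x
      exact p.deriv
    rw [h, ih, Function.iterate_succ_apply]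

open Polynomial in
theorem Mhat_add_two (k : ℕ) (x : ℝ) :
    Mhat (k + 2) x = (1 / ((2 : ℝ) ^ (k + 1) * (Nat.factorial (k + 1) : ℝ))) *
      (derivative^[k] ((X ^ 2 - 1 : ℝ[X]) ^ (k + 1))).eval x := by
  have h : (fun y : ℝ => (y ^ 2 - 1) ^ (k + 1)) =
      fun y => ((X ^ 2 - 1 : ℝ[X]) ^ (k + 1)).eval y := by
    funext y
    simp
  rw [Mhat, h, iteratedDeriv_poly_eval]

open Polynomial in
theorem Mhat_poly (i : ℕ) : ∃ p : ℝ[X], p.natDegree ≤ i ∧ ∀ x, Mhat i x = p.eval x := by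
  match i with
  | 0 => exact ⟨1, by simp, fun x => by simp [Mhat]⟩
  | 1 => exact ⟨X, by simp, fun x => by simp [Mhat]⟩
  | k + 2 =>
    refine ⟨C (1 / ((2 : ℝ) ^ (k + 1) * (Nat.factorial (k + 1) : ℝ))) *
      derivative^[k] ((X ^ 2 - 1 : ℝ[X]) ^ (k + 1)), ?_, fun x => ?_⟩
    · refine (natDegree_C_mul_le _ _).trans ((natDegree_iterate_derivative _ _).trans ?_)
      have h1 : (X ^ 2 - 1 : ℝ[X]).natDegree ≤ 2 := by compute_degree
      have h2 := natDegree_pow_le_of_le (k + 1) h1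
      omega
    · rw [Mhat_add_two, eval_mul, eval_C]

theorem Mhat_neg (i : ℕ) (x : ℝ) : Mhat i (-x) = (-1) ^ i * Mhat i x := by
  match i with
  | 0 => simp [Mhat]
  | 1 => simp [Mhat]
  | k + 2 =>
    have h := iteratedDeriv_comp_neg k (fun y : ℝ => (y ^ 2 - 1) ^ (k + 1)) (-x)
    simp only [neg_sq, neg_neg, smul_eq_mul] at h
    simp only [Mhat]
    rw [h]
    ring

open Polynomial in
theorem integral_poly_mul_deriv (N n : ℕ) (hn : n ≤ N) (p : ℝ[X]) (hp : derivative^[n] p = 0) :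
    ∫ x in (-1 : ℝ)..1, p.eval x * (derivative^[n] ((X ^ 2 - 1 : ℝ[X]) ^ N)).eval x = 0 := by
  induction n generalizing p with
  | zero =>
    simp only [Function.iterate_zero, id_eq] at hp
    simp [hp]
  | succ n ih =>
    have hroot : ∀ a : ℝ, a ^ 2 = 1 →
        (derivative^[n] ((X ^ 2 - 1 : ℝ[X]) ^ N)).eval a = 0 := by
      intro a ha
      obtain ⟨q, hq⟩ := pow_sub_dvd_iterate_derivative_of_pow_dvd n
        (dvd_refl ((X ^ 2 - 1 : ℝ[X]) ^ N))
      rw [hq]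
      have : N - n ≠ 0 := by omega
      simp [ha, this]
    have key := intervalIntegral.integral_mul_deriv_eq_deriv_mul (a := -1) (b := 1)
      (u := fun x => p.eval x) (u' := fun x => (derivative p).eval x)
      (v := fun x => (derivative^[n] ((X ^ 2 - 1 : ℝ[X]) ^ N)).eval x)
      (v' := fun x => (derivative^[n + 1] ((X ^ 2 - 1 : ℝ[X]) ^ N)).eval x)
      (fun x _ => p.hasDerivAt x)
      (fun x _ => by
        rw [Function.iterate_succ_apply']
        exact Polynomial.hasDerivAt _ x)
      ((derivative p).continuous.intervalIntegrable _ _)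
      ((Polynomial.continuous _).intervalIntegrable _ _)
    rw [key, hroot 1 (by norm_num), hroot (-1) (by norm_num),
      ih (by omega) (derivative p) (by rwa [Function.iterate_succ_apply] at hp)]
    simp

theorem Mhat_orthogonal_of_add_three_le (i j : ℕ) (h : i + 3 ≤ j) :
    ∫ x in (-1 : ℝ)..1, Mhat i x * Mhat j x = 0 := by
  obtain ⟨k, rfl⟩ : ∃ k, j = k + 2 := ⟨j - 2, by omega⟩
  obtain ⟨p, hp, hpe⟩ := Mhat_poly i
  have key := integral_poly_mul_deriv (k + 1) k (by omega) p
    (Polynomial.iterate_derivative_eq_zero (by omega))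
  simp only [hpe, Mhat_add_two, mul_left_comm]
  rw [intervalIntegral.integral_const_mul, key, mul_zero]

theorem Mhat_orthogonal_of_odd (i j : ℕ) (h : Odd (i + j)) :
    ∫ x in (-1 : ℝ)..1, Mhat i x * Mhat j x = 0 := by
  have h1 := intervalIntegral.integral_comp_neg (a := -1) (b := 1)
    (fun x => Mhat i x * Mhat j x)
  have h2 : ∀ x, Mhat i (-x) * Mhat j (-x) = -(Mhat i x * Mhat j x) := by
    intro x
    rw [Mhat_neg, Mhat_neg]
    have := h.neg_one_pow (α := ℝ)
    rw [pow_add] at this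
    linear_combination (Mhat i x * Mhat j x) * this
  simp only [h2, intervalIntegral.integral_neg, neg_neg] at h1
  linarith

/-- For all `i ≠ j` with `|i - j| ≠ 2`, the M-functions are L²-orthogonal on `[-1,1]`. -/
theorem Mhat_orthogonal (i j : ℕ) (hij : i ≠ j) (h2 : ((i : ℤ) - (j : ℤ)).natAbs ≠ 2) :
    ∫ x in (-1 : ℝ)..1, Mhat i x * Mhat j x = 0 := by
  rcases Nat.even_or_odd (i + j) with he | ho
  · obtain ⟨m, hm⟩ := he
    rcases lt_or_gt_of_ne hij with h | h
    · exact Mhat_orthogonal_of_add_three_le i j (by omega)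
    · simp only [mul_comm (Mhat i _)]
      exact Mhat_orthogonal_of_add_three_le j i (by omega)
  · exact Mhat_orthogonal_of_odd i j ho
end

section
/- The operator Π satisfies the k-r-order orthogonality condition, i.e. ∫_{-1}^{1} g(x)(w(x) - (Π w)(x)) dx = 0 for every real polynomial g of degree ≤ r and every real polynomial w of degree ≤ 1, if and only if the k-r-order moment equations hold. -/
open Finset

/-- The trial-to-test operator `Π`: for dividing points `α_0 = -1 < α_1 < ... < α_k < α_{k+1} = 1`
and interpolation points `a_s`, `(Π w)(x) = w(a_s)` for `x ∈ (α_s, α_{s+1})`. -/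
noncomputable def piOp (k : ℕ) (a α : ℕ → ℝ) (w : ℝ → ℝ) (x : ℝ) : ℝ :=
  ∑ s ∈ Finset.range (k + 1), if α s < x ∧ x < α (s + 1) then w (a s) else 0

/-- The `k`-`r`-order moment equations:
`Σ_{s=1}^{k} (a_s - a_{s-1}) α_s^{i+1} = (1-(-1)^i)/(i+2)` for all `0 ≤ i ≤ r`. -/
def momentEqs (k r : ℕ) (a α : ℕ → ℝ) : Prop :=
  ∀ i ≤ r, ∑ s ∈ Finset.Icc 1 k, (a s - a (s - 1)) * (α s) ^ (i + 1)
    = (1 - (-1 : ℝ) ^ i) / ((i : ℝ) + 2)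

open MeasureTheory

theorem pi_term (p q c : ℝ) (hp : -1 ≤ p) (hpq : p ≤ q) (hq : q ≤ 1) (f : ℝ → ℝ)
    (hf : Continuous f) :
    IntervalIntegrable (fun x => f x * (if p < x ∧ x < q then c else 0)) volume (-1) 1 ∧
    ∫ x in (-1 : ℝ)..1, f x * (if p < x ∧ x < q then c else 0) = c * ∫ x in p..q, f x := by
  have e : (fun x => f x * (if p < x ∧ x < q then c else 0))
      = (Set.Ioo p q).indicator (fun x => c * f x) := by
    funext x
    by_cases h : p < x ∧ x < q
    · rw [if_pos h, Set.indicator_of_mem (show x ∈ Set.Ioo p q from h), mul_comm]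
    · rw [if_neg h, Set.indicator_of_notMem (show x ∉ Set.Ioo p q from h), mul_zero]
  have h11 : (-1 : ℝ) ≤ 1 := by norm_num
  have hsub : Set.Ioo p q ⊆ Set.Ioc (-1) 1 := fun x hx => ⟨hp.trans_lt hx.1, hx.2.le.trans hq⟩
  rw [e]
  constructor
  · rw [intervalIntegrable_iff_integrableOn_Ioc_of_le h11]
    have : IntegrableOn (fun x => c * f x) (Set.Ioc (-1) 1) volume :=
      ((continuous_const.mul hf).intervalIntegrable (-1) 1).1
    exact Integrable.indicator this measurableSet_Ioo
  · rw [intervalIntegral.integral_of_le h11, setIntegral_indicator measurableSet_Ioo,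
      Set.inter_eq_self_of_subset_right hsub, ← integral_Ioc_eq_integral_Ioo,
      ← intervalIntegral.integral_of_le hpq, intervalIntegral.integral_const_mul]

theorem pi_int (k : ℕ) (a α : ℕ → ℝ)
    (h : ∀ s ≤ k, -1 ≤ α s ∧ α s ≤ α (s + 1) ∧ α (s + 1) ≤ 1) (f w : ℝ → ℝ)
    (hf : Continuous f) (hw : Continuous w) :
    IntervalIntegrable (fun x => f x * (w x - piOp k a α w x)) volume (-1) 1 ∧
    ∫ x in (-1 : ℝ)..1, f x * (w x - piOp k a α w x)
      = (∫ x in (-1 : ℝ)..1, f x * w x)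
        - ∑ s ∈ range (k + 1), w (a s) * ∫ x in (α s)..(α (s + 1)), f x := by
  have e : (fun x => f x * (w x - piOp k a α w x)) = fun x => f x * w x -
      ∑ s ∈ range (k + 1), f x * (if α s < x ∧ x < α (s + 1) then w (a s) else 0) := by
    funext x
    rw [piOp, mul_sub, mul_sum]
  have H : ∀ s ∈ range (k + 1), _ := fun s hs =>
    have hs' := h s (Nat.lt_succ_iff.mp (mem_range.mp hs))
    pi_term (α s) (α (s + 1)) (w (a s)) hs'.1 hs'.2.1 hs'.2.2 f hf
  have i1 : IntervalIntegrable (fun x => f x * w x) volume (-1) 1 :=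
    (hf.mul hw).intervalIntegrable _ _
  have i2 : IntervalIntegrable (fun x => ∑ s ∈ range (k + 1),
      f x * (if α s < x ∧ x < α (s + 1) then w (a s) else 0)) volume (-1) 1 := by
    have := IntervalIntegrable.sum (range (k + 1)) (fun s hs => (H s hs).1)
    have e' : (fun x => ∑ s ∈ range (k + 1),
        f x * (if α s < x ∧ x < α (s + 1) then w (a s) else 0)) = ∑ s ∈ range (k + 1),
        fun x => f x * (if α s < x ∧ x < α (s + 1) then w (a s) else 0) := by
      funext x
      rw [Finset.sum_apply]
    rw [e']
    exact this
  rw [e]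
  refine ⟨i1.sub i2, ?_⟩
  rw [intervalIntegral.integral_sub i1 i2,
    intervalIntegral.integral_finsetSum (fun s hs => (H s hs).1)]
  congr 1
  exact sum_congr rfl fun s hs => (H s hs).2

theorem abel_aux (u v : ℕ → ℝ) (k : ℕ) :
    ∑ s ∈ range (k + 1), u s * (v (s + 1) - v s)
      = u k * v (k + 1) - u 0 * v 0 - ∑ s ∈ Icc 1 k, (u s - u (s - 1)) * v s := by
  induction k with
  | zero => simp; ring
  | succ n ih =>
    rw [sum_range_succ, ih, sum_Icc_succ_top (by omega)]
    simp only [Nat.add_sub_cancel]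
    ring

theorem mono_int (k : ℕ) (a α : ℕ → ℝ)
    (h : ∀ s ≤ k, -1 ≤ α s ∧ α s ≤ α (s + 1) ∧ α (s + 1) ≤ 1)
    (ha0 : a 0 = -1) (hak : a k = 1) (hα0 : α 0 = -1) (hαtop : α (k + 1) = 1)
    (c d : ℝ) (i : ℕ) :
    ((i : ℝ) + 1) * ∫ x in (-1 : ℝ)..1, x ^ i * ((c + d * x) - piOp k a α (fun t => c + d * t) x)
      = d * (∑ s ∈ Icc 1 k, (a s - a (s - 1)) * (α s) ^ (i + 1)
          - (1 - (-1 : ℝ) ^ i) / ((i : ℝ) + 2)) := by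
  rw [(pi_int k a α h (fun x => x ^ i) (fun t => c + d * t) (by fun_prop) (by fun_prop)).2]
  have e1 : ∫ x in (-1 : ℝ)..1, x ^ i * (c + d * x)
      = c * ((1 - (-1) ^ (i + 1)) / (i + 1)) + d * ((1 - (-1) ^ (i + 2)) / (i + 2)) := by
    have : (fun x : ℝ => x ^ i * (c + d * x)) = fun x => c * x ^ i + d * x ^ (i + 1) := by
      funext x; ring
    rw [this, intervalIntegral.integral_add (Continuous.intervalIntegrable (by fun_prop) _ _)
      (Continuous.intervalIntegrable (by fun_prop) _ _), intervalIntegral.integral_const_mul,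
      intervalIntegral.integral_const_mul, integral_pow, integral_pow]
    push_cast
    simp only [one_pow, add_assoc]
    norm_num
  have hi1 : (i : ℝ) + 1 ≠ 0 := by positivity
  have hi2 : (i : ℝ) + 2 ≠ 0 := by positivity
  have e2 : ((i : ℝ) + 1) * ∑ s ∈ range (k + 1), (c + d * a s) * ∫ x in (α s)..(α (s + 1)), x ^ i
      = ∑ s ∈ range (k + 1), (c + d * a s) * ((α (s + 1)) ^ (i + 1) - (α s) ^ (i + 1)) := by
    rw [mul_sum]
    refine sum_congr rfl fun s _ => ?_
    rw [integral_pow]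
    field_simp
  have e3 := abel_aux (fun s => c + d * a s) (fun s => α s ^ (i + 1)) k
  have e4 : ∑ s ∈ Icc 1 k, ((c + d * a s) - (c + d * a (s - 1))) * α s ^ (i + 1)
      = d * ∑ s ∈ Icc 1 k, (a s - a (s - 1)) * (α s) ^ (i + 1) := by
    rw [mul_sum]
    exact sum_congr rfl fun s _ => by ring
  rw [mul_sub, e2, e3, e4, e1, ha0, hak, hα0, hαtop]
  field_simp
  ring

/-- The operator `Π` satisfies the `k`-`r`-order orthogonality condition iff the
`k`-`r`-order moment equations hold. -/
theorem orthogonality_iff_momentEqs (k r : ℕ) (hk : 1 ≤ k) (a α : ℕ → ℝ)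
    (ha0 : a 0 = -1) (hak : a k = 1)
    (hamono : ∀ s t : ℕ, s < t → t ≤ k → a s < a t)
    (hinter : ∀ s : ℕ, 1 ≤ s → s ≤ k → a (s - 1) < α s ∧ α s < a s)
    (hα0 : α 0 = -1) (hαtop : α (k + 1) = 1) :
    (∀ g w : Polynomial ℝ, g.natDegree ≤ r → w.natDegree ≤ 1 →
        ∫ x in (-1 : ℝ)..1,
          g.eval x * (w.eval x - piOp k a α (fun t => w.eval t) x) = 0)
      ↔ momentEqs k r a α := by
  have hαa : ∀ s, 1 ≤ s → s ≤ k → -1 ≤ α s ∧ α s ≤ 1 := by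
    intro s h1 h2
    obtain ⟨h3, h4⟩ := hinter s h1 h2
    constructor
    · rcases Nat.eq_zero_or_pos (s - 1) with h | h
      · rw [h, ha0] at h3; exact h3.le
      · have := hamono 0 (s - 1) h (by omega)
        rw [ha0] at this; linarith
    · rcases h2.eq_or_lt with h | h
      · rw [h, hak] at h4; rw [h]; exact h4.le
      · have := hamono s k h le_rfl
        rw [hak] at this; linarith
  have h : ∀ s ≤ k, -1 ≤ α s ∧ α s ≤ α (s + 1) ∧ α (s + 1) ≤ 1 := by
    intro s hs
    have A : -1 ≤ α s ∧ α s ≤ 1 := by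
      rcases Nat.eq_zero_or_pos s with h | h
      · rw [h, hα0]; norm_num
      · exact hαa s h hs
    rcases hs.eq_or_lt with h | h
    · rw [h, hαtop]; rw [h] at A; exact ⟨A.1, A.2, le_rfl⟩
    · refine ⟨A.1, ?_, (hαa (s + 1) (by omega) h).2⟩
      have h5 := (hinter (s + 1) (by omega) h).1
      simp only [Nat.add_sub_cancel] at h5
      rcases Nat.eq_zero_or_pos s with h0 | h0
      · rw [h0, ha0] at h5; rw [h0, hα0]; exact h5.le
      · have := (hinter s h0 hs).2
        linarith
  have key := mono_int k a α h ha0 hak hα0 hαtop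
  constructor
  · intro H i hi
    have h1 := H (Polynomial.X ^ i) Polynomial.X (by simpa using hi) (by simp)
    have h2 := key 0 1 i
    simp only [zero_add, one_mul] at h2
    simp only [Polynomial.eval_pow, Polynomial.eval_X] at h1
    rw [h1, mul_zero] at h2
    linarith
  · intro M g w hg hw
    have hw' : ∀ x, w.eval x = w.coeff 0 + w.coeff 1 * x := by
      intro x
      rw [Polynomial.eval_eq_sum_range' (Nat.lt_succ_of_le hw)]
      simp [sum_range_succ]
    simp only [hw']
    have e : ∀ x, g.eval x = ∑ i ∈ range (r + 1), g.coeff i * x ^ i := fun x =>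
      Polynomial.eval_eq_sum_range' (Nat.lt_succ_of_le hg) x
    simp only [e, sum_mul, mul_assoc]
    rw [intervalIntegral.integral_finsetSum]
    · refine sum_eq_zero fun i hi => ?_
      rw [intervalIntegral.integral_const_mul]
      have h2 := key (w.coeff 0) (w.coeff 1) i
      rw [M i (Nat.lt_succ_iff.mp (mem_range.mp hi)), sub_self, mul_zero] at h2
      have hi1 : (i : ℝ) + 1 ≠ 0 := by positivity
      rw [(mul_eq_zero.mp h2).resolve_left hi1, mul_zero]
    · intro i _
      exact (pi_int k a α h (fun x => x ^ i) (fun t => w.coeff 0 + w.coeff 1 * t)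
        (by fun_prop) (by fun_prop)).1.const_mul _
end

section
/- Suppose the tensorial k-r-order orthogonality condition holds. Let p_x denote the coordinate function p_x(x,y) = x. Then for every integer i with 0 ≤ i ≤ r and every real polynomial g₁ of one variable (of arbitrary degree), ∫∫_{[-1,1]²} g₁(y) · x^i · (x - (Π p_x)(x,y)) dx dy = 0. -/
open Finset

/-- The tensor-product trial-to-test operator `Π` on `K̂ = [-1,1]²`:
`(Π w)(x,y) = w(aˣ_s, aʸ_t)` for `(x,y) ∈ (αˣ_s, αˣ_{s+1}) × (αʸ_t, αʸ_{t+1})`. -/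
noncomputable def piOp2 (k : ℕ) (ax ay αx αy : ℕ → ℝ) (w : ℝ → ℝ → ℝ) (x y : ℝ) : ℝ :=
  ∑ s ∈ Finset.range (k + 1), ∑ t ∈ Finset.range (k + 1),
    if (αx s < x ∧ x < αx (s + 1)) ∧ (αy t < y ∧ y < αy (t + 1)) then w (ax s) (ay t) else 0

open MeasureTheory in
/-- Exactly one open cell contains a point off the nodes. -/
lemma cell_sum_one (n : ℕ) (α : ℕ → ℝ) (hmono : ∀ s < n, α s < α (s + 1)) (y : ℝ)
    (h0 : α 0 < y) (hn : y ≤ α n) (hne : ∀ s ≤ n, y ≠ α s) :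
    ∑ t ∈ Finset.range n, (if α t < y ∧ y < α (t + 1) then (1 : ℝ) else 0) = 1 := by
  have h : ∀ t ∈ Finset.range n, (if α t < y ∧ y < α (t + 1) then (1 : ℝ) else 0)
      = (if α t < y then (1 : ℝ) else 0) - (if α (t + 1) < y then (1 : ℝ) else 0) := by
    intro t ht
    have ht' := Finset.mem_range.1 ht
    have h1 := hmono t ht'
    have h2 := hne (t + 1) (by omega)
    rcases lt_or_gt_of_ne h2 with h3 | h3
    · simp [h3, not_lt.2 h3.le]
    · simp [h3, not_lt.2 h3.le, h1.trans h3]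
  rw [Finset.sum_congr rfl h, Finset.sum_range_sub']
  simp [h0, not_lt.2 hn]

lemma nodes_mono (k : ℕ) (hk : 1 ≤ k) (a α : ℕ → ℝ)
    (ha0 : a 0 = -1) (hak : a k = 1)
    (hinter : ∀ s : ℕ, 1 ≤ s → s ≤ k → a (s - 1) < α s ∧ α s < a s)
    (hα0 : α 0 = -1) (hαtop : α (k + 1) = 1) :
    ∀ s < k + 1, α s < α (s + 1) := by
  intro s hs
  rcases Nat.eq_zero_or_pos s with rfl | hs0
  · have := (hinter 1 le_rfl hk).1
    simp only [Nat.sub_self] at this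
    rw [hα0, ← ha0]; exact this
  · rcases Nat.lt_or_ge s k with h | h
    · have h1 := (hinter s hs0 h.le).2
      have h2 := (hinter (s + 1) (by omega) h).1
      simp only [Nat.add_sub_cancel] at h2
      exact h1.trans h2
    · obtain rfl : s = k := by omega
      rw [hαtop, ← hak]; exact (hinter s hk le_rfl).2

lemma nodes_bound (n : ℕ) (α : ℕ → ℝ) (hmono : ∀ s < n, α s < α (s + 1)) :
    ∀ t ≤ n, ∀ s ≤ t, α s ≤ α t := by
  intro t
  induction t with
  | zero => intro _ s hs; obtain rfl : s = 0 := by omega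
            exact le_rfl
  | succ t ih =>
    intro ht s hs
    rcases Nat.lt_or_ge s (t + 1) with h | h
    · exact (ih (by omega) s (by omega)).trans (hmono t (by omega)).le
    · obtain rfl : s = t + 1 := by omega
      exact le_rfl

lemma abel_sum (k : ℕ) (a b : ℕ → ℝ) :
    ∑ s ∈ Finset.range (k + 1), a s * (b (s + 1) - b s)
      = a k * b (k + 1) - a 0 * b 0 - ∑ s ∈ Finset.Icc 1 k, (a s - a (s - 1)) * b s := by
  induction k with
  | zero => simp; ring
  | succ k ih =>
    rw [Finset.sum_range_succ, ih, Finset.sum_Icc_succ_top (by omega)]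
    simp only [Nat.add_sub_cancel]
    ring

open MeasureTheory in
lemma cell_integral (i : ℕ) (c p q : ℝ) (hp : -1 ≤ p) (hpq : p ≤ q) (hq : q ≤ 1) :
    IntervalIntegrable (fun x : ℝ => x ^ i * (if p < x ∧ x < q then c else 0)) volume (-1) 1 ∧
    ∫ x in (-1 : ℝ)..1, x ^ i * (if p < x ∧ x < q then c else 0)
      = c * (q ^ (i + 1) - p ^ (i + 1)) / (i + 1) := by
  have e : (fun x : ℝ => x ^ i * (if p < x ∧ x < q then c else 0))
      = (Set.Ioo p q).indicator (fun x => x ^ i * c) := by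
    funext x
    simp [Set.indicator_apply, Set.mem_Ioo]
  rw [e]
  have hc : Continuous (fun x : ℝ => x ^ i * c) := by fun_prop
  constructor
  · have := hc.intervalIntegrable (μ := volume) (-1) 1
    rw [intervalIntegrable_iff] at this ⊢
    exact this.indicator measurableSet_Ioo
  · rw [intervalIntegral.integral_of_le (by norm_num), setIntegral_indicator measurableSet_Ioo,
      Set.inter_eq_right.2, ← integral_Ioc_eq_integral_Ioo, ← intervalIntegral.integral_of_le hpq,
      intervalIntegral.integral_mul_const, integral_pow]
    · ring
    · intro x hx
      exact ⟨hp.trans_lt hx.1, hx.2.le.trans hq⟩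

/-- Under the tensorial `k`-`r`-order orthogonality condition, for every `i ≤ r` and every
univariate polynomial `g₁`, `∫∫_{[-1,1]²} g₁(y) xⁱ (x - (Π pₓ)(x,y)) dx dy = 0`, where
`pₓ(x,y) = x`. -/
theorem tensorial_orth_x (k r : ℕ) (hk : 1 ≤ k) (ax ay αx αy : ℕ → ℝ)
    (hax0 : ax 0 = -1) (haxk : ax k = 1)
    (haxmono : ∀ s t : ℕ, s < t → t ≤ k → ax s < ax t)
    (hxinter : ∀ s : ℕ, 1 ≤ s → s ≤ k → ax (s - 1) < αx s ∧ αx s < ax s)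
    (hαx0 : αx 0 = -1) (hαxtop : αx (k + 1) = 1)
    (hay0 : ay 0 = -1) (hayk : ay k = 1)
    (haymono : ∀ s t : ℕ, s < t → t ≤ k → ay s < ay t)
    (hyinter : ∀ s : ℕ, 1 ≤ s → s ≤ k → ay (s - 1) < αy s ∧ αy s < ay s)
    (hαy0 : αy 0 = -1) (hαytop : αy (k + 1) = 1)
    (hmx : momentEqs k r ax αx) (hmy : momentEqs k r ay αy) :
    ∀ i ≤ r, ∀ g₁ : Polynomial ℝ,
      (∫ y in (-1 : ℝ)..1, ∫ x in (-1 : ℝ)..1,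
        g₁.eval y * x ^ i * (x - piOp2 k ax ay αx αy (fun x _ => x) x y)) = 0 := by
  intro i hi g₁
  have hxm := nodes_mono k hk ax αx hax0 haxk hxinter hαx0 hαxtop
  have hym := nodes_mono k hk ay αy hay0 hayk hyinter hαy0 hαytop
  have hbd := nodes_bound (k + 1) αx hxm
  have hcell : ∀ s ∈ Finset.range (k + 1), _ := fun s hs =>
    cell_integral i (ax s) (αx s) (αx (s + 1))
      (hαx0 ▸ hbd s (Finset.mem_range.1 hs).le 0 (Nat.zero_le _))
      (hxm s (Finset.mem_range.1 hs)).le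
      (hαxtop ▸ hbd (k + 1) le_rfl (s + 1) (Finset.mem_range.1 hs))
  have hkey : ∀ y : ℝ, y ∈ Set.Ioc (-1 : ℝ) 1 → (∀ s ≤ k + 1, y ≠ αy s) →
      (∫ x in (-1 : ℝ)..1,
        g₁.eval y * x ^ i * (x - piOp2 k ax ay αx αy (fun x _ => x) x y)) = 0 := by
    intro y hy hne
    have hone := cell_sum_one (k + 1) αy hym y (hαy0 ▸ hy.1) (hαytop ▸ hy.2) hne
    have hpi : ∀ x, piOp2 k ax ay αx αy (fun x _ => x) x y
        = ∑ s ∈ Finset.range (k + 1), (if αx s < x ∧ x < αx (s + 1) then ax s else 0) := by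
      intro x
      unfold piOp2
      refine Finset.sum_congr rfl fun s _ => ?_
      rw [← mul_one (if αx s < x ∧ x < αx (s + 1) then ax s else 0), ← hone, Finset.mul_sum]
      refine Finset.sum_congr rfl fun t _ => ?_
      by_cases h1 : αx s < x ∧ x < αx (s + 1) <;>
        by_cases h2 : αy t < y ∧ y < αy (t + 1) <;> simp only [h1, h2] <;> simp
    have hfun : (fun x : ℝ => g₁.eval y * x ^ i *
          (x - piOp2 k ax ay αx αy (fun x _ => x) x y))
        = fun x => g₁.eval y * (x ^ (i + 1) - ∑ s ∈ Finset.range (k + 1),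
            x ^ i * (if αx s < x ∧ x < αx (s + 1) then ax s else 0)) := by
      funext x
      rw [hpi, ← Finset.mul_sum]
      ring
    rw [hfun, intervalIntegral.integral_const_mul, intervalIntegral.integral_sub
      ((continuous_pow (i + 1)).intervalIntegrable _ _) ?_,
      intervalIntegral.integral_finsetSum (fun s hs => (hcell s hs).1),
      Finset.sum_congr rfl (fun s hs => (hcell s hs).2), integral_pow,
      ← Finset.sum_div, abel_sum k ax (fun s => αx s ^ (i + 1)), hmx i hi]
    · simp only [haxk, hax0, hαx0, hαxtop, one_pow, pow_succ]
      have h1 : (i : ℝ) + 1 ≠ 0 := by positivity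
      have h2 : (i : ℝ) + 2 ≠ 0 := by positivity
      have h3 : (i : ℝ) + 1 + 1 ≠ 0 := by positivity
      push_cast
      rw [mul_eq_zero]
      right
      field_simp
      ring
    · have := IntervalIntegrable.sum (Finset.range (k + 1)) (fun s hs => (hcell s hs).1)
      rw [Finset.sum_fn] at this
      exact this
  have hfin : (((Finset.range (k + 2)).image αy : Finset ℝ) : Set ℝ).Finite :=
    Finset.finite_toSet _
  have hae := hfin.countable.ae_notMem (MeasureTheory.volume : MeasureTheory.Measure ℝ)
  apply intervalIntegral.integral_zero_ae
  filter_upwards [hae] with y hy hyI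
  rw [Set.uIoc_of_le (by norm_num)] at hyI
  refine hkey y hyI fun s hs h => hy ?_
  rw [h]
  exact Finset.mem_coe.2 (Finset.mem_image_of_mem _ (Finset.mem_range.2 (by omega)))
end

section
/- Suppose the tensorial k-r-order orthogonality condition holds. Let p_y denote the coordinate function p_y(x,y) = y. Then for every integer i with 0 ≤ i ≤ r and every real polynomial g₂ of one variable (of arbitrary degree), ∫∫_{[-1,1]²} g₂(x) · y^i · (y - (Π p_y)(x,y)) dx dy = 0. -/
open Finset

lemma alpha_mono_aux (k : ℕ) (a α : ℕ → ℝ) (hk : 1 ≤ k)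
    (ha0 : a 0 = -1) (hak : a k = 1)
    (hinter : ∀ s : ℕ, 1 ≤ s → s ≤ k → a (s - 1) < α s ∧ α s < a s)
    (hα0 : α 0 = -1) (hαtop : α (k + 1) = 1) :
    ∀ s, s ≤ k → α s ≤ α (s + 1) := by
  intro s hs
  rcases Nat.eq_zero_or_pos s with rfl | hpos
  · have h := (hinter 1 le_rfl hk).1
    simp only [Nat.sub_self] at h
    rw [hα0]
    simp only [zero_add]
    linarith
  · have h1 := (hinter s hpos hs).2
    rcases Nat.lt_or_ge s k with hlt | hge
    · have h2 := (hinter (s + 1) (by omega) (by omega)).1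
      simp only [Nat.add_sub_cancel] at h2
      linarith
    · have : s = k := by omega
      subst this
      linarith

lemma alpha_range_aux (k : ℕ) (α : ℕ → ℝ) (hm : ∀ s, s ≤ k → α s ≤ α (s + 1)) :
    ∀ s, s ≤ k + 1 → α 0 ≤ α s ∧ α s ≤ α (k + 1) := by
  intro s hs
  constructor
  · induction s with
    | zero => exact le_rfl
    | succ n ih => exact (ih (by omega)).trans (hm n (by omega))
  · induction hs using Nat.decreasingInduction with
    | self => exact le_rfl
    | of_succ n hn ih => exact (hm n (by omega)).trans ih

lemma ite_mul_indicator_aux (f : ℝ → ℝ) (c p q : ℝ) :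
    (fun x => f x * (if p < x ∧ x < q then c else 0))
      = Set.indicator (Set.Ioo p q) (fun x => f x * c) := by
  funext x
  simp only [Set.indicator, Set.mem_Ioo]
  split_ifs <;> simp

lemma piece_integrable_aux (f : ℝ → ℝ) (hf : Continuous f) (c p q u v : ℝ) :
    IntervalIntegrable (fun x => f x * (if p < x ∧ x < q then c else 0))
      MeasureTheory.volume u v := by
  rw [ite_mul_indicator_aux]
  have h : IntervalIntegrable (fun x => f x * c) MeasureTheory.volume u v :=
    (hf.mul continuous_const).intervalIntegrable u v
  exact ⟨h.1.indicator measurableSet_Ioo, h.2.indicator measurableSet_Ioo⟩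

lemma piece_integral_aux (f : ℝ → ℝ) (c p q : ℝ)
    (hp : -1 ≤ p) (hpq : p ≤ q) (hq : q ≤ 1) :
    ∫ x in (-1 : ℝ)..1, f x * (if p < x ∧ x < q then c else 0)
      = c * ∫ x in p..q, f x := by
  have hsub : Set.Ioo p q ⊆ Set.Ioc (-1 : ℝ) 1 :=
    fun x hx => ⟨by linarith [hx.1], by linarith [hx.2]⟩
  rw [ite_mul_indicator_aux, intervalIntegral.integral_of_le (by linarith),
    intervalIntegral.integral_of_le hpq,
    MeasureTheory.setIntegral_indicator measurableSet_Ioo,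
    Set.inter_eq_right.mpr hsub,
    ← MeasureTheory.integral_Ioc_eq_integral_Ioo, MeasureTheory.integral_mul_const, mul_comm]

lemma sum_integral_aux (k : ℕ) (α c : ℕ → ℝ) (hm : ∀ s, s ≤ k → α s ≤ α (s + 1))
    (hα0 : α 0 = -1) (hαtop : α (k + 1) = 1) (f : ℝ → ℝ) (hf : Continuous f) :
    IntervalIntegrable (fun x => f x * ∑ t ∈ Finset.range (k + 1),
      if α t < x ∧ x < α (t + 1) then c t else 0) MeasureTheory.volume (-1) 1 ∧
    ∫ x in (-1 : ℝ)..1, f x * ∑ t ∈ Finset.range (k + 1),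
      (if α t < x ∧ x < α (t + 1) then c t else 0)
      = ∑ t ∈ Finset.range (k + 1), c t * ∫ x in α t..α (t + 1), f x := by
  have hr := alpha_range_aux k α hm
  simp only [Finset.mul_sum]
  constructor
  · have := IntervalIntegrable.sum (μ := MeasureTheory.volume) (a := -1) (b := 1)
      (Finset.range (k + 1))
      (f := fun t x => f x * (if α t < x ∧ x < α (t + 1) then c t else 0))
      (fun t _ => piece_integrable_aux f hf _ _ _ _ _)
    have he : (fun x => ∑ t ∈ Finset.range (k + 1),
        f x * (if α t < x ∧ x < α (t + 1) then c t else 0))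
        = ∑ t ∈ Finset.range (k + 1),
          fun x => f x * (if α t < x ∧ x < α (t + 1) then c t else 0) := by
      funext x
      rw [Finset.sum_apply]
    rw [he]
    exact this
  · rw [intervalIntegral.integral_finsetSum
      (fun t _ => piece_integrable_aux f hf _ _ _ _ _)]
    refine Finset.sum_congr rfl fun t ht => ?_
    have ht' := Finset.mem_range.mp ht
    refine piece_integral_aux f _ _ _ ?_ (hm t (by omega)) ?_
    · rw [← hα0]; exact (hr t (by omega)).1
    · rw [← hαtop]; exact (hr (t + 1) (by omega)).2

lemma abel_aux_s6 (k : ℕ) (a b : ℕ → ℝ) :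
    ∑ t ∈ Finset.range (k + 1), a t * (b (t + 1) - b t)
      = a k * b (k + 1) - a 0 * b 0 - ∑ s ∈ Finset.Icc 1 k, (a s - a (s - 1)) * b s := by
  induction k with
  | zero => simp; ring
  | succ n ih =>
    rw [Finset.sum_range_succ, ih, Finset.sum_Icc_succ_top (by omega)]
    simp only [Nat.add_sub_cancel]
    ring

/-- Under the tensorial `k`-`r`-order orthogonality condition, for every `i ≤ r` and every
univariate polynomial `g₁`, `∫∫_{[-1,1]²} g₂(x) yⁱ (y - (Π p_y)(x,y)) dx dy = 0`, where
`p_y(x,y) = y`. -/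
theorem tensorial_orth_y (k r : ℕ) (hk : 1 ≤ k) (ax ay αx αy : ℕ → ℝ)
    (hax0 : ax 0 = -1) (haxk : ax k = 1)
    (haxmono : ∀ s t : ℕ, s < t → t ≤ k → ax s < ax t)
    (hxinter : ∀ s : ℕ, 1 ≤ s → s ≤ k → ax (s - 1) < αx s ∧ αx s < ax s)
    (hαx0 : αx 0 = -1) (hαxtop : αx (k + 1) = 1)
    (hay0 : ay 0 = -1) (hayk : ay k = 1)
    (haymono : ∀ s t : ℕ, s < t → t ≤ k → ay s < ay t)
    (hyinter : ∀ s : ℕ, 1 ≤ s → s ≤ k → ay (s - 1) < αy s ∧ αy s < ay s)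
    (hαy0 : αy 0 = -1) (hαytop : αy (k + 1) = 1)
    (hmx : momentEqs k r ax αx) (hmy : momentEqs k r ay αy) :
    ∀ i ≤ r, ∀ g₂ : Polynomial ℝ,
      (∫ y in (-1 : ℝ)..1, ∫ x in (-1 : ℝ)..1,
        g₂.eval x * y ^ i * (y - piOp2 k ax ay αx αy (fun _ y => y) x y)) = 0 := by
  intro i hi g₂
  have hmX := alpha_mono_aux k ax αx hk hax0 haxk hxinter hαx0 hαxtop
  have hmY := alpha_mono_aux k ay αy hk hay0 hayk hyinter hαy0 hαytop
  have hg : Continuous (fun x : ℝ => g₂.eval x) := g₂.continuous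
  set T : ℝ → ℝ := fun y => ∑ t ∈ Finset.range (k + 1),
    if αy t < y ∧ y < αy (t + 1) then ay t else 0 with hT
  set S : ℝ → ℝ := fun x => ∑ s ∈ Finset.range (k + 1),
    if αx s < x ∧ x < αx (s + 1) then (1 : ℝ) else 0 with hS
  have hpi : ∀ x y, piOp2 k ax ay αx αy (fun _ y => y) x y = S x * T y := by
    intro x y
    simp only [piOp2, hS, hT, Finset.sum_mul_sum]
    refine Finset.sum_congr rfl fun s _ => Finset.sum_congr rfl fun t _ => ?_
    by_cases h1 : αx s < x ∧ x < αx (s + 1) <;>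
      by_cases h2 : αy t < y ∧ y < αy (t + 1) <;> simp [h1, h2]
  obtain ⟨hxi, hxv⟩ := sum_integral_aux k αx (fun _ => 1) hmX hαx0 hαxtop _ hg
  have hxv' : ∫ x in (-1 : ℝ)..1, g₂.eval x * S x = ∫ x in (-1 : ℝ)..1, g₂.eval x := by
    rw [hS, hxv]
    simp only [one_mul]
    rw [intervalIntegral.sum_integral_adjacent_intervals
      (fun _ _ => hg.intervalIntegrable _ _), hαx0, hαxtop]
  have hinner : ∀ y : ℝ, ∫ x in (-1 : ℝ)..1,
      g₂.eval x * y ^ i * (y - piOp2 k ax ay αx αy (fun _ y => y) x y)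
      = (∫ x in (-1 : ℝ)..1, g₂.eval x) * (y ^ (i + 1) - y ^ i * T y) := by
    intro y
    have h1 : ∀ x : ℝ, g₂.eval x * y ^ i * (y - piOp2 k ax ay αx αy (fun _ y => y) x y)
        = g₂.eval x * y ^ (i + 1) - g₂.eval x * S x * (y ^ i * T y) := by
      intro x
      rw [hpi]
      ring
    simp only [h1]
    rw [intervalIntegral.integral_sub ((hg.intervalIntegrable _ _).mul_const _)
      (IntervalIntegrable.mul_const hxi _), intervalIntegral.integral_mul_const,
      intervalIntegral.integral_mul_const, hxv']
    ring
  simp only [hinner]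
  obtain ⟨hyi, hyv⟩ := sum_integral_aux k αy ay hmY hαy0 hαytop (fun y => y ^ i)
    (continuous_pow i)
  rw [intervalIntegral.integral_const_mul, intervalIntegral.integral_sub
    ((continuous_pow (i + 1)).intervalIntegrable _ _) hyi, hyv]
  have hab := abel_aux_s6 k ay (fun t => αy t ^ (i + 1))
  have hm := hmy i hi
  simp only [hm, hay0, hayk, hαy0, hαytop] at hab
  simp only [integral_pow]
  have h2 : ∀ t, ay t * ((αy (t + 1) ^ (i + 1) - αy t ^ (i + 1)) / ((i : ℝ) + 1))
      = (ay t * (αy (t + 1) ^ (i + 1) - αy t ^ (i + 1))) / ((i : ℝ) + 1) := fun t => by ring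
  simp only [h2]
  rw [← Finset.sum_div, hab]
  have h3 : ((i : ℝ) + 1) ≠ 0 := by positivity
  have h4 : ((i : ℝ) + 2) ≠ 0 := by positivity
  have h5 : ((i : ℝ) + 1 + 1) ≠ 0 := by positivity
  rw [mul_eq_zero]
  right
  push_cast
  have h6 : ((i : ℝ) + 1 + 1) = (i : ℝ) + 2 := by ring
  rw [h6]
  field_simp
  simp only [one_pow, pow_succ]
  ring
end

section
/- Suppose the tensorial k-r-order orthogonality condition holds. Then for every real polynomial g₃(x,y) of degree at most r in each of the two variables separately, and every affine function w(x,y) = c₀ + c₁ x + c₂ y, one has ∫∫_{[-1,1]²} g₃(x,y) (w(x,y) - (Π w)(x,y)) dx dy = 0. -/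
open Finset

/-- `f` is integrable on `[-1,1]` with integral `v`. -/
def HasJ (f : ℝ → ℝ) (v : ℝ) : Prop :=
  IntervalIntegrable f MeasureTheory.volume (-1) 1 ∧ ∫ x in (-1 : ℝ)..1, f x = v

theorem HasJ.add {f g : ℝ → ℝ} {u v : ℝ} (hf : HasJ f u) (hg : HasJ g v) :
    HasJ (fun x => f x + g x) (u + v) :=
  ⟨hf.1.add hg.1, by rw [intervalIntegral.integral_add hf.1 hg.1, hf.2, hg.2]⟩

theorem HasJ.sub {f g : ℝ → ℝ} {u v : ℝ} (hf : HasJ f u) (hg : HasJ g v) :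
    HasJ (fun x => f x - g x) (u - v) :=
  ⟨hf.1.sub hg.1, by rw [intervalIntegral.integral_sub hf.1 hg.1, hf.2, hg.2]⟩

theorem HasJ.smul {f : ℝ → ℝ} {u : ℝ} (c : ℝ) (hf : HasJ f u) :
    HasJ (fun x => c * f x) (c * u) :=
  ⟨hf.1.const_mul c, by rw [intervalIntegral.integral_const_mul, hf.2]⟩

theorem HasJ.sum {s : Finset ℕ} {f : ℕ → ℝ → ℝ} {u : ℕ → ℝ}
    (hf : ∀ i ∈ s, HasJ (f i) (u i)) :
    HasJ (fun x => ∑ i ∈ s, f i x) (∑ i ∈ s, u i) := by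
  refine ⟨?_, ?_⟩
  · have := IntervalIntegrable.sum s (fun i hi => (hf i hi).1)
    have e : (fun x => ∑ i ∈ s, f i x) = ∑ i ∈ s, f i := by
      ext x
      simp
    rw [e]
    exact this
  · rw [intervalIntegral.integral_finsetSum (fun i hi => (hf i hi).1)]
    exact Finset.sum_congr rfl fun i hi => (hf i hi).2

theorem hasJ_pow (i : ℕ) : HasJ (fun x => x ^ i) ((1 - (-1) ^ (i + 1)) / ((i : ℝ) + 1)) :=
  ⟨(continuous_pow i).intervalIntegrable _ _, by rw [integral_pow]; simp⟩

theorem hasJ_chi (i : ℕ) (b u v : ℝ) (hu : -1 ≤ u) (huv : u ≤ v) (hv : v ≤ 1) :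
    HasJ (fun x => x ^ i * (if u < x ∧ x < v then b else 0))
      (b * ((v ^ (i + 1) - u ^ (i + 1)) / ((i : ℝ) + 1))) := by
  have e : (fun x : ℝ => x ^ i * (if u < x ∧ x < v then b else 0))
      = (Set.Ioo u v).indicator (fun x => b * x ^ i) := by
    ext x
    simp only [Set.indicator, Set.mem_Ioo]
    split_ifs <;> ring
  have hc : Continuous (fun x : ℝ => b * x ^ i) := by fun_prop
  rw [e]
  constructor
  · have h1 := hc.intervalIntegrable (μ := MeasureTheory.volume) (-1) 1
    rw [intervalIntegrable_iff] at h1 ⊢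
    exact h1.indicator measurableSet_Ioo
  · rw [intervalIntegral.integral_of_le (by norm_num),
      MeasureTheory.setIntegral_indicator measurableSet_Ioo]
    have : Set.Ioc (-1 : ℝ) 1 ∩ Set.Ioo u v = Set.Ioo u v := by
      apply Set.inter_eq_right.2
      intro x hx
      exact ⟨by linarith [hx.1], by linarith [hx.2]⟩
    rw [this, ← MeasureTheory.integral_Ioc_eq_integral_Ioo,
      ← intervalIntegral.integral_of_le huv, intervalIntegral.integral_const_mul, integral_pow]

/-- One-dimensional piecewise constant function. -/
noncomputable def step (k : ℕ) (α b : ℕ → ℝ) (x : ℝ) : ℝ :=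
  ∑ s ∈ Finset.range (k + 1), if α s < x ∧ x < α (s + 1) then b s else 0

theorem alpha_mono (k : ℕ) (a α : ℕ → ℝ) (ha0 : a 0 = -1) (hak : a k = 1)
    (hi : ∀ s : ℕ, 1 ≤ s → s ≤ k → a (s - 1) < α s ∧ α s < a s)
    (h0 : α 0 = -1) (ht : α (k + 1) = 1) (s : ℕ) (hs : s ≤ k) : α s ≤ α (s + 1) := by
  have h1 : α s ≤ a s := by
    rcases Nat.eq_zero_or_pos s with rfl | h
    · rw [h0, ha0]
    · exact (hi s h hs).2.le
  have h2 : a s ≤ α (s + 1) := by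
    rcases hs.eq_or_lt with rfl | h
    · rw [ht, hak]
    · exact (hi (s + 1) (by omega) h).1.le
  exact h1.trans h2

theorem hasJ_step (k i : ℕ) (α b : ℕ → ℝ) (h0 : α 0 = -1) (ht : α (k + 1) = 1)
    (hm : ∀ s ≤ k, α s ≤ α (s + 1)) :
    HasJ (fun x => x ^ i * step k α b x)
      (∑ s ∈ Finset.range (k + 1), b s * ((α (s + 1) ^ (i + 1) - α s ^ (i + 1)) / ((i : ℝ) + 1))) := by
  have lo : ∀ s ≤ k + 1, -1 ≤ α s := by
    intro s
    induction s with
    | zero => intro _; rw [h0]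
    | succ n ih => intro h; exact (ih (by omega)).trans (hm n (by omega))
  have hi : ∀ d s, s + d = k + 1 → α s ≤ 1 := by
    intro d
    induction d with
    | zero => intro s h; rw [show s = k + 1 by omega, ht]
    | succ n ih => intro s h; exact (hm s (by omega)).trans (ih (s + 1) (by omega))
  simp only [step, Finset.mul_sum]
  apply HasJ.sum
  intro s hs
  have hs' : s < k + 1 := Finset.mem_range.1 hs
  exact hasJ_chi i _ _ _ (lo s hs'.le) (hm s (by omega)) (hi (k - s) (s + 1) (by omega))

theorem hasJ_one (k i : ℕ) (α : ℕ → ℝ) (h0 : α 0 = -1) (ht : α (k + 1) = 1)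
    (hm : ∀ s ≤ k, α s ≤ α (s + 1)) :
    HasJ (fun x => x ^ i * step k α (fun _ => 1) x) ((1 - (-1) ^ (i + 1)) / ((i : ℝ) + 1)) := by
  convert hasJ_step k i α (fun _ => 1) h0 ht hm using 1
  simp only [one_mul]
  rw [← Finset.sum_div, Finset.sum_range_sub (fun s => α s ^ (i + 1)), h0, ht, one_pow]

theorem abel (k : ℕ) (a p : ℕ → ℝ) :
    ∑ s ∈ Finset.range (k + 1), a s * (p (s + 1) - p s)
      = a k * p (k + 1) - a 0 * p 0 - ∑ s ∈ Finset.Icc 1 k, (a s - a (s - 1)) * p s := by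
  induction k with
  | zero => simp; ring
  | succ n ih =>
    rw [Finset.sum_range_succ, ih, Finset.sum_Icc_succ_top (by omega)]
    simp only [Nat.add_sub_cancel]
    ring

theorem hasJ_a (k r i : ℕ) (hir : i ≤ r) (a α : ℕ → ℝ) (ha0 : a 0 = -1) (hak : a k = 1)
    (h0 : α 0 = -1) (ht : α (k + 1) = 1)
    (hm : ∀ s ≤ k, α s ≤ α (s + 1)) (he : momentEqs k r a α) :
    HasJ (fun x => x ^ i * step k α a x)
      ((1 - (-1) ^ (i + 1 + 1)) / (((i + 1 : ℕ) : ℝ) + 1)) := by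
  convert hasJ_step k i α a h0 ht hm using 1
  simp only [← mul_div_assoc]
  rw [← Finset.sum_div, abel k a (fun s => α s ^ (i + 1)), he i hir, h0, ht, ha0, hak]
  have : (i : ℝ) + 1 ≠ 0 := by positivity
  have : (i : ℝ) + 2 ≠ 0 := by positivity
  push_cast
  rw [show (i : ℝ) + 1 + 1 = i + 2 by ring]
  field_simp
  ring

theorem piOp2_affine (k : ℕ) (ax ay αx αy : ℕ → ℝ) (c₀ c₁ c₂ x y : ℝ) :
    piOp2 k ax ay αx αy (fun x y => c₀ + c₁ * x + c₂ * y) x y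
      = c₀ * (step k αx (fun _ => 1) x * step k αy (fun _ => 1) y)
        + c₁ * (step k αx ax x * step k αy (fun _ => 1) y)
        + c₂ * (step k αx (fun _ => 1) x * step k αy ay y) := by
  simp only [piOp2, step, Finset.sum_mul_sum]
  simp only [Finset.mul_sum, ← Finset.sum_add_distrib]
  refine Finset.sum_congr rfl fun s _ => Finset.sum_congr rfl fun t _ => ?_
  by_cases h1 : αx s < x ∧ x < αx (s + 1) <;> by_cases h2 : αy t < y ∧ y < αy (t + 1) <;>
    simp [h1, h2]

/-- Under the tensorial `k`-`r`-order orthogonality condition, for every bivariate polynomial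
`g₃(x,y) = Σ_{i,j ≤ r} c i j xⁱ yʲ` of degree at most `r` in each variable separately and every
affine `w(x,y) = c₀ + c₁ x + c₂ y`, `∫∫_{[-1,1]²} g₃ (w - Π w) dx dy = 0`. -/
theorem tensorial_orth_affine (k r : ℕ) (hk : 1 ≤ k) (ax ay αx αy : ℕ → ℝ)
    (hax0 : ax 0 = -1) (haxk : ax k = 1)
    (haxmono : ∀ s t : ℕ, s < t → t ≤ k → ax s < ax t)
    (hxinter : ∀ s : ℕ, 1 ≤ s → s ≤ k → ax (s - 1) < αx s ∧ αx s < ax s)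
    (hαx0 : αx 0 = -1) (hαxtop : αx (k + 1) = 1)
    (hay0 : ay 0 = -1) (hayk : ay k = 1)
    (haymono : ∀ s t : ℕ, s < t → t ≤ k → ay s < ay t)
    (hyinter : ∀ s : ℕ, 1 ≤ s → s ≤ k → ay (s - 1) < αy s ∧ αy s < ay s)
    (hαy0 : αy 0 = -1) (hαytop : αy (k + 1) = 1)
    (hmx : momentEqs k r ax αx) (hmy : momentEqs k r ay αy) :
    ∀ (c : ℕ → ℕ → ℝ) (c₀ c₁ c₂ : ℝ),
      (∫ y in (-1 : ℝ)..1, ∫ x in (-1 : ℝ)..1,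
        (∑ i ∈ Finset.range (r + 1), ∑ j ∈ Finset.range (r + 1), c i j * x ^ i * y ^ j) *
          ((c₀ + c₁ * x + c₂ * y)
            - piOp2 k ax ay αx αy (fun x y => c₀ + c₁ * x + c₂ * y) x y)) = 0 := by
  intro c c₀ c₁ c₂
  have hmX := alpha_mono k ax αx hax0 haxk hxinter hαx0 hαxtop
  have hmY := alpha_mono k ay αy hay0 hayk hyinter hαy0 hαytop
  set m : ℕ → ℝ := fun i => (1 - (-1) ^ (i + 1)) / ((i : ℝ) + 1) with hmdef
  have inner : ∀ y : ℝ, (∫ x in (-1 : ℝ)..1,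
        (∑ i ∈ Finset.range (r + 1), ∑ j ∈ Finset.range (r + 1), c i j * x ^ i * y ^ j) *
          ((c₀ + c₁ * x + c₂ * y)
            - piOp2 k ax ay αx αy (fun x y => c₀ + c₁ * x + c₂ * y) x y))
      = ∑ i ∈ Finset.range (r + 1), ∑ j ∈ Finset.range (r + 1),
        ((c i j * (c₀ * m i + c₁ * m (i + 1))) * (y ^ j - y ^ j * step k αy (fun _ => 1) y)
          + (c i j * c₂ * m i) * (y ^ (j + 1) - y ^ j * step k αy ay y)) := by
    intro y
    have key : HasJ (fun x => ∑ i ∈ Finset.range (r + 1), ∑ j ∈ Finset.range (r + 1),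
        ((c i j * y ^ j * (c₀ + c₂ * y)) * x ^ i + (c i j * y ^ j * c₁) * x ^ (i + 1)
         - ((c i j * y ^ j * (c₀ * step k αy (fun _ => 1) y + c₂ * step k αy ay y))
              * (x ^ i * step k αx (fun _ => 1) x)
            + (c i j * y ^ j * c₁ * step k αy (fun _ => 1) y) * (x ^ i * step k αx ax x))))
      (∑ i ∈ Finset.range (r + 1), ∑ j ∈ Finset.range (r + 1),
        ((c i j * y ^ j * (c₀ + c₂ * y)) * m i + (c i j * y ^ j * c₁) * m (i + 1)
         - ((c i j * y ^ j * (c₀ * step k αy (fun _ => 1) y + c₂ * step k αy ay y)) * m i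
            + (c i j * y ^ j * c₁ * step k αy (fun _ => 1) y) * m (i + 1)))) := by
      refine HasJ.sum fun i hi => HasJ.sum fun j _ => ?_
      have hir : i ≤ r := by have := Finset.mem_range.1 hi; omega
      exact (((hasJ_pow i).smul _).add ((hasJ_pow (i + 1)).smul _)).sub
        (((hasJ_one k i αx hαx0 hαxtop hmX).smul _).add
          ((hasJ_a k r i hir ax αx hax0 haxk hαx0 hαxtop hmX hmx).smul _))
    refine Eq.trans ?_ (key.2.trans ?_)
    · congr 1
      ext x
      rw [piOp2_affine, Finset.sum_mul]
      refine Finset.sum_congr rfl fun i _ => ?_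
      rw [Finset.sum_mul]
      refine Finset.sum_congr rfl fun j _ => ?_
      ring
    · refine Finset.sum_congr rfl fun i _ => Finset.sum_congr rfl fun j _ => ?_
      ring
  simp only [inner]
  have key : HasJ (fun y => ∑ i ∈ Finset.range (r + 1), ∑ j ∈ Finset.range (r + 1),
        ((c i j * (c₀ * m i + c₁ * m (i + 1))) * (y ^ j - y ^ j * step k αy (fun _ => 1) y)
          + (c i j * c₂ * m i) * (y ^ (j + 1) - y ^ j * step k αy ay y)))
      (∑ i ∈ Finset.range (r + 1), ∑ j ∈ Finset.range (r + 1),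
        ((c i j * (c₀ * m i + c₁ * m (i + 1))) * (m j - m j)
          + (c i j * c₂ * m i) * (m (j + 1) - m (j + 1)))) := by
    refine HasJ.sum fun i _ => HasJ.sum fun j hj => ?_
    have hjr : j ≤ r := by have := Finset.mem_range.1 hj; omega
    exact (((hasJ_pow j).sub (hasJ_one k j αy hαy0 hαytop hmY)).smul _).add
      (((hasJ_pow (j + 1)).sub
        (hasJ_a k r j hjr ay αy hay0 hayk hαy0 hαytop hmY hmy)).smul _)
  rw [key.2]
  simp
end

section
/- There is a constant C depending only on k with the following property. Let u : ℝ² → ℝ be of class C^{k+3} with |∂²_x ∂^{k+1}_y u| ≤ M everywhere, let h > 0, and let x₀ < x₁ < x₂ and y₀ < y₁ be reals with x₁ - x₀ ≤ h, x₂ - x₁ ≤ h, and y₁ - y₀ ≤ h. Then for the adjacent rectangles K₁ = [x₀,x₁] × [y₀,y₁] and K₂ = [x₁,x₂] × [y₀,y₁] one has | b(K₁)/(x₁-x₀) − b(K₂)/(x₂-x₁) | ≤ C · M · h^{k+2}. -/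
/-- The mixed partial derivative `∂^{k+2} u / ∂x ∂y^{k+1}`: once in the first variable and
`k+1` times in the second variable. -/
noncomputable def pdMixed (k : ℕ) (u : ℝ → ℝ → ℝ) (x y : ℝ) : ℝ :=
  deriv (fun s => iteratedDeriv (k + 1) (fun t => u s t) y) x

/-- The M-decomposition coefficient `b(K)` of `u` on the rectangle
`K = [p, p+h_x] × [q, q+h_y]`. -/
noncomputable def bcoef (k : ℕ) (u : ℝ → ℝ → ℝ) (p q hx hy : ℝ) : ℝ :=
  (hx / 2) * (hy / 2) ^ (k + 1) *
    (((2 * (k : ℝ) + 1) * (-1 : ℝ) ^ k) / ((2 : ℝ) ^ (k + 2) * (Nat.factorial k : ℝ))) *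
    ∫ yh in (-1 : ℝ)..1, ∫ xh in (-1 : ℝ)..1,
      pdMixed k u (p + hx * (xh + 1) / 2) (q + hy * (yh + 1) / 2) * (yh ^ 2 - 1) ^ k

theorem contDiff_dy (m : ℕ) (f : ℝ → ℝ → ℝ) (hf : ContDiff ℝ (m + 1 : ℕ) (Function.uncurry f)) :
    ContDiff ℝ (m : ℕ) (Function.uncurry (fun s t => deriv (f s) t)) := by
  have h1 : ContDiff ℝ (m : ℕ) (fun p : ℝ × ℝ => fderiv ℝ (Function.uncurry f) p (0, 1)) :=
    (hf.fderiv_right (by norm_cast)).clm_apply contDiff_const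
  have hd : Differentiable ℝ (Function.uncurry f) := hf.differentiable (by norm_cast)
  convert h1 using 1
  ext ⟨s, t⟩
  have h2 : HasDerivAt (fun t : ℝ => (s, t)) ((0 : ℝ), (1 : ℝ)) t :=
    (hasDerivAt_const t s).prodMk (hasDerivAt_id t)
  exact ((hd (s, t)).hasFDerivAt.comp_hasDerivAt t h2).deriv

theorem contDiff_dx (m : ℕ) (f : ℝ → ℝ → ℝ) (hf : ContDiff ℝ (m + 1 : ℕ) (Function.uncurry f)) :
    ContDiff ℝ (m : ℕ) (Function.uncurry (fun s t => deriv (fun r => f r t) s)) := by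
  have h1 : ContDiff ℝ (m : ℕ) (fun p : ℝ × ℝ => fderiv ℝ (Function.uncurry f) p (1, 0)) :=
    (hf.fderiv_right (by norm_cast)).clm_apply contDiff_const
  have hd : Differentiable ℝ (Function.uncurry f) := hf.differentiable (by norm_cast)
  convert h1 using 1
  ext ⟨s, t⟩
  have h2 : HasDerivAt (fun s : ℝ => (s, t)) ((1 : ℝ), (0 : ℝ)) s :=
    (hasDerivAt_id s).prodMk (hasDerivAt_const s t)
  exact ((hd (s, t)).hasFDerivAt.comp_hasDerivAt s h2).deriv

theorem contDiff_iter (j : ℕ) : ∀ (m : ℕ) (f : ℝ → ℝ → ℝ),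
    ContDiff ℝ (m + j : ℕ) (Function.uncurry f) →
    ContDiff ℝ (m : ℕ) (Function.uncurry (fun s t => iteratedDeriv j (f s) t)) := by
  induction j with
  | zero => intro m f hf; simpa using hf
  | succ j ih =>
    intro m f hf
    have := contDiff_dy m _ (ih (m + 1) f (by convert hf using 2; omega))
    simpa only [iteratedDeriv_succ] using this

theorem pdMixed_contDiff (k : ℕ) (u : ℝ → ℝ → ℝ)
    (hu : ContDiff ℝ (k + 3 : ℕ) (Function.uncurry u)) :
    ContDiff ℝ (1 : ℕ) (Function.uncurry (pdMixed k u)) :=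
  contDiff_dx 1 _ (contDiff_iter (k + 1) 2 u (by convert hu using 2; omega))

theorem pdMixed_lip (k : ℕ) (u : ℝ → ℝ → ℝ) (M : ℝ)
    (hu : ContDiff ℝ (k + 3 : ℕ) (Function.uncurry u))
    (hM : ∀ x y : ℝ,
      |iteratedDeriv 2 (fun s => iteratedDeriv (k + 1) (fun t => u s t) y) x| ≤ M)
    (a b y : ℝ) : |pdMixed k u a y - pdMixed k u b y| ≤ M * |a - b| := by
  have hd : Differentiable ℝ (fun s => pdMixed k u s y) := by
    have := (pdMixed_contDiff k u hu).differentiable (by norm_num)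
    exact this.comp (differentiable_id.prodMk (differentiable_const y))
  refine Convex.norm_image_sub_le_of_norm_deriv_le (f := fun s => pdMixed k u s y)
    (fun x _ => hd x) (fun x _ => ?_) convex_univ (Set.mem_univ b) (Set.mem_univ a)
  have := hM x y
  rw [iteratedDeriv_succ, iteratedDeriv_one] at this
  exact this

/-- There is a constant `C` depending only on `k` such that for every `C^{k+3}` function `u`
with `|∂²ₓ ∂^{k+1}_y u| ≤ M` everywhere, and adjacent rectangles
`K₁ = [x₀,x₁]×[y₀,y₁]`, `K₂ = [x₁,x₂]×[y₀,y₁]` with side lengths at most `h`,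
`| b(K₁)/(x₁-x₀) − b(K₂)/(x₂-x₁) | ≤ C M h^{k+2}`. -/
theorem bcoef_adjacent_estimate (k : ℕ) (hk : 1 ≤ k) :
    ∃ C : ℝ, 0 < C ∧
      ∀ (u : ℝ → ℝ → ℝ) (M h x₀ x₁ x₂ y₀ y₁ : ℝ),
        ContDiff ℝ (k + 3 : ℕ) (Function.uncurry u) →
        (∀ x y : ℝ, |iteratedDeriv 2 (fun s => iteratedDeriv (k + 1) (fun t => u s t) y) x| ≤ M) →
        0 < h → x₀ < x₁ → x₁ < x₂ → y₀ < y₁ →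
        x₁ - x₀ ≤ h → x₂ - x₁ ≤ h → y₁ - y₀ ≤ h →
        |bcoef k u x₀ y₀ (x₁ - x₀) (y₁ - y₀) / (x₁ - x₀)
          - bcoef k u x₁ y₀ (x₂ - x₁) (y₁ - y₀) / (x₂ - x₁)|
          ≤ C * M * h ^ (k + 2) := by
  obtain ⟨c, hc⟩ : ∃ c : ℝ, c = ((2 * (k : ℝ) + 1) * (-1 : ℝ) ^ k) /
      ((2 : ℝ) ^ (k + 2) * (Nat.factorial k : ℝ)) := ⟨_, rfl⟩
  refine ⟨4 * |c| + 1, by positivity, ?_⟩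
  intro u M h x₀ x₁ x₂ y₀ y₁ hu hM hh h01 h12 hy hx1 hx2 hy1
  have hM0 : 0 ≤ M := (abs_nonneg _).trans (hM 0 0)
  have hcont : Continuous (Function.uncurry (pdMixed k u)) := (pdMixed_contDiff k u hu).continuous
  let F : ℝ → ℝ → ℝ → ℝ → ℝ := fun p d yh xh =>
    pdMixed k u (p + d * (xh + 1) / 2) (y₀ + (y₁ - y₀) * (yh + 1) / 2) * (yh ^ 2 - 1) ^ k
  have hF : ∀ p d, Continuous (Function.uncurry (F p d)) := by
    intro p d
    have h1 : Continuous (fun q : ℝ × ℝ => Function.uncurry (pdMixed k u)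
      (p + d * (q.2 + 1) / 2, y₀ + (y₁ - y₀) * (q.1 + 1) / 2)) := hcont.comp (by fun_prop)
    exact h1.mul (by fun_prop)
  have hFx : ∀ p d yh, Continuous (F p d yh) := by
    intro p d yh
    have h1 : Continuous (fun xh : ℝ => (yh, xh)) := by fun_prop
    have h2 := Continuous.comp (hF p d) h1
    exact h2
  have hI : ∀ p d, Continuous (fun yh => ∫ xh in (-1 : ℝ)..1, F p d yh xh) := fun p d =>
    intervalIntegral.continuous_parametric_intervalIntegral_of_continuous' (hF p d) _ _
  have hpt : ∀ yh ∈ Set.uIoc (-1 : ℝ) 1, ∀ xh ∈ Set.uIoc (-1 : ℝ) 1,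
      ‖F x₀ (x₁ - x₀) yh xh - F x₁ (x₂ - x₁) yh xh‖ ≤ M * (2 * h) := by
    intro yh hyh xh hxh
    rw [Set.uIoc_of_le (by norm_num)] at hyh hxh
    obtain ⟨hy1, hy2⟩ := hyh
    obtain ⟨hxa, hxb⟩ := hxh
    simp only [F]
    rw [← sub_mul, norm_mul, norm_pow, Real.norm_eq_abs, Real.norm_eq_abs]
    have e1 : |yh ^ 2 - 1| ^ k ≤ 1 := by
      apply pow_le_one₀ (abs_nonneg _)
      rw [abs_le]; constructor <;> nlinarith
    have e2 := pdMixed_lip k u M hu hM (x₀ + (x₁ - x₀) * (xh + 1) / 2)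
      (x₁ + (x₂ - x₁) * (xh + 1) / 2) (y₀ + (y₁ - y₀) * (yh + 1) / 2)
    have e3 : |x₀ + (x₁ - x₀) * (xh + 1) / 2 - (x₁ + (x₂ - x₁) * (xh + 1) / 2)| ≤ 2 * h := by
      rw [abs_le]; constructor <;> nlinarith
    calc _ ≤ (M * (2 * h)) * 1 :=
          mul_le_mul (e2.trans (mul_le_mul_of_nonneg_left e3 hM0)) e1 (by positivity)
            (by positivity)
      _ = _ := mul_one _
  have hint : |(∫ yh in (-1 : ℝ)..1, ∫ xh in (-1 : ℝ)..1, F x₀ (x₁ - x₀) yh xh)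
      - ∫ yh in (-1 : ℝ)..1, ∫ xh in (-1 : ℝ)..1, F x₁ (x₂ - x₁) yh xh| ≤ 8 * M * h := by
    rw [← intervalIntegral.integral_sub ((hI _ _).intervalIntegrable _ _)
      ((hI _ _).intervalIntegrable _ _), ← Real.norm_eq_abs]
    have := intervalIntegral.norm_integral_le_of_norm_le_const (a := (-1 : ℝ)) (b := 1)
      (C := M * (2 * h) * |1 - (-1 : ℝ)|)
      (f := fun yh => (∫ xh in (-1 : ℝ)..1, F x₀ (x₁ - x₀) yh xh)
        - ∫ xh in (-1 : ℝ)..1, F x₁ (x₂ - x₁) yh xh) (by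
        intro yh hyh
        rw [← intervalIntegral.integral_sub ((hFx _ _ _).intervalIntegrable _ _)
          ((hFx _ _ _).intervalIntegrable _ _)]
        exact intervalIntegral.norm_integral_le_of_norm_le_const (hpt yh hyh))
    refine this.trans (le_of_eq ?_)
    norm_num; ring
  have key : bcoef k u x₀ y₀ (x₁ - x₀) (y₁ - y₀) / (x₁ - x₀)
          - bcoef k u x₁ y₀ (x₂ - x₁) (y₁ - y₀) / (x₂ - x₁)
      = (1 / 2) * ((y₁ - y₀) / 2) ^ (k + 1) * c *
        ((∫ yh in (-1 : ℝ)..1, ∫ xh in (-1 : ℝ)..1, F x₀ (x₁ - x₀) yh xh)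
      - ∫ yh in (-1 : ℝ)..1, ∫ xh in (-1 : ℝ)..1, F x₁ (x₂ - x₁) yh xh) := by
    have n1 : x₁ - x₀ ≠ 0 := by linarith
    have n2 : x₂ - x₁ ≠ 0 := by linarith
    simp only [bcoef, ← hc]
    change _ * _ * c * (∫ yh in (-1 : ℝ)..1, ∫ xh in (-1 : ℝ)..1, F x₀ (x₁ - x₀) yh xh) / _
      - _ * _ * c * (∫ yh in (-1 : ℝ)..1, ∫ xh in (-1 : ℝ)..1, F x₁ (x₂ - x₁) yh xh) / _ = _
    generalize (∫ yh in (-1 : ℝ)..1, ∫ xh in (-1 : ℝ)..1, F x₀ (x₁ - x₀) yh xh) = A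
    generalize (∫ yh in (-1 : ℝ)..1, ∫ xh in (-1 : ℝ)..1, F x₁ (x₂ - x₁) yh xh) = B
    generalize ((y₁ - y₀) / 2) ^ (k + 1) = D
    field_simp
  have hD : ((y₁ - y₀) / 2) ^ (k + 1) ≤ h ^ (k + 1) :=
    pow_le_pow_left₀ (by linarith) (by linarith) _
  have hD0 : 0 ≤ ((y₁ - y₀) / 2) ^ (k + 1) := pow_nonneg (by linarith) _
  rw [key, abs_mul, abs_mul, abs_mul, abs_of_nonneg hD0]
  calc _ ≤ |(1 / 2 : ℝ)| * h ^ (k + 1) * |c| * (8 * M * h) := by gcongr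
    _ = 4 * |c| * M * h ^ (k + 2) := by
        rw [abs_of_pos (by norm_num)]; ring
    _ ≤ _ := by
        have : 0 ≤ M * h ^ (k + 2) := by positivity
        nlinarith
end

section
/- Suppose the k-r-order moment equations hold with r = k-1 (and k ≥ 2). Let b*_2, ..., b*_k, b_{k+1} be reals and set R(x) = Σ_{s=2}^{k} b*_s M̂_s(x) + b_{k+1} M̂_{k+1}(x). If R'(α_m) = 0 for every m = 1, ..., k-1, then also R'(α_k) = 0. -/
open Finset

/-- Each `Mhat (i+2)` is a polynomial function of degree at most `i+2` vanishing at `±1`. -/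
lemma Mhat_poly_s10 (i : ℕ) : ∃ P : Polynomial ℝ, (∀ x, Mhat (i + 2) x = P.eval x) ∧
    P.natDegree ≤ i + 2 ∧ P.eval 1 = 0 ∧ P.eval (-1) = 0 := by
  set Q : Polynomial ℝ := (Polynomial.X ^ 2 - 1) ^ (i + 1) with hQ
  have hit : ∀ (n : ℕ) (p : Polynomial ℝ),
      iteratedDeriv n (fun y => p.eval y) = fun y => (Polynomial.derivative^[n] p).eval y := by
    intro n
    induction n with
    | zero => intro p; simp
    | succ n ih =>
      intro p
      rw [iteratedDeriv_succ, ih]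
      funext y
      rw [Polynomial.deriv, Function.iterate_succ_apply']
  have hroot : ∀ c : ℝ, c ^ 2 = 1 → (Polynomial.derivative^[i] Q).eval c = 0 := by
    intro c hc
    have h1 : (Polynomial.X - Polynomial.C c) ∣ (Polynomial.X ^ 2 - 1 : Polynomial ℝ) := by
      rw [Polynomial.dvd_iff_isRoot]
      simp [hc]
    have h2 := Polynomial.pow_sub_dvd_iterate_derivative_of_pow_dvd i (pow_dvd_pow_of_dvd h1 (i + 1))
    rw [show i + 1 - i = 1 by omega, pow_one, Polynomial.dvd_iff_isRoot] at h2
    exact h2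
  refine ⟨Polynomial.C (1 / ((2 : ℝ) ^ (i + 1) * (Nat.factorial (i + 1) : ℝ))) *
    Polynomial.derivative^[i] Q, ?_, ?_, ?_, ?_⟩
  · intro x
    have h := congrFun (hit i Q) x
    have hf : (fun y : ℝ => Q.eval y) = fun y => (y ^ 2 - 1) ^ (i + 1) := by
      funext y; simp [hQ]
    rw [hf] at h
    rw [Polynomial.eval_mul, Polynomial.eval_C, ← h]
    rfl
  · refine (Polynomial.natDegree_C_mul_le _ _).trans
      ((Polynomial.natDegree_iterate_derivative _ _).trans ?_)
    have h3 : (Polynomial.X ^ 2 - 1 : Polynomial ℝ).natDegree ≤ 2 := by compute_degree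
    have h4 : Q.natDegree ≤ (i + 1) * 2 :=
      Polynomial.natDegree_pow_le_of_le (i + 1) h3
    omega
  · rw [Polynomial.eval_mul, hroot 1 (by norm_num), mul_zero]
  · rw [Polynomial.eval_mul, hroot (-1) (by norm_num), mul_zero]

/-- The quadrature rule is exact on derivatives of polynomials of degree at most `k+1`. -/
lemma quad_exact (k : ℕ) (hk : 2 ≤ k) (a α : ℕ → ℝ) (ha0 : a 0 = -1) (hak : a k = 1)
    (hm : momentEqs k (k - 1) a α) (P : Polynomial ℝ) (hP : P.natDegree ≤ k + 1) :
    ∑ s ∈ Finset.Icc 1 k, (a s - a (s - 1)) * P.derivative.eval (α s)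
      = P.eval 1 - P.eval (-1) := by
  have hmom : ∀ j ≤ k, ((j : ℝ) + 1) * ∑ s ∈ Finset.Icc 1 k, (a s - a (s - 1)) * (α s) ^ j
      = 1 - (-1 : ℝ) ^ (j + 1) := by
    intro j hj
    rcases j with _ | j
    · have ht : ∀ n, ∑ s ∈ Finset.Icc 1 n, (a s - a (s - 1)) = a n - a 0 := by
        intro n
        induction n with
        | zero => simp
        | succ n ih => rw [Finset.sum_Icc_succ_top (by omega), ih]; simp
      simp only [pow_zero, mul_one, ht, ha0, hak]
      norm_num
    · rw [hm j (by omega)]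
      have : (j : ℝ) + 2 ≠ 0 := by positivity
      push_cast
      field_simp
      ring
  have hd : P.derivative.natDegree < k + 1 :=
    lt_of_le_of_lt (Polynomial.natDegree_derivative_le P) (by omega)
  simp_rw [Polynomial.eval_eq_sum_range' hd, Polynomial.eval_eq_sum_range' (Nat.lt_succ_of_le hP),
    Finset.mul_sum]
  rw [Finset.sum_comm, ← Finset.sum_sub_distrib, Finset.sum_range_succ' _ (k + 1)]
  simp only [pow_zero, sub_self, add_zero]
  refine Finset.sum_congr rfl fun j hj => ?_
  have h := hmom j (by have := Finset.mem_range.1 hj; omega)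
  rw [one_pow, ← mul_sub, ← h, Finset.mul_sum, Finset.mul_sum]
  refine Finset.sum_congr rfl fun s _ => ?_
  rw [Polynomial.coeff_derivative]
  ring

/-- Under the `k`-`(k-1)`-order moment equations (`k ≥ 2`), if
`R = Σ_{s=2}^{k} b*_s M̂_s + b_{k+1} M̂_{k+1}` satisfies `R'(α_m) = 0` for `m = 1, ..., k-1`,
then also `R'(α_k) = 0`. -/
theorem deriv_vanishes_at_last_dual_point_super (k : ℕ) (hk : 2 ≤ k) (a α : ℕ → ℝ)
    (ha0 : a 0 = -1) (hak : a k = 1)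
    (hamono : ∀ s t : ℕ, s < t → t ≤ k → a s < a t)
    (hinter : ∀ s : ℕ, 1 ≤ s → s ≤ k → a (s - 1) < α s ∧ α s < a s)
    (hm : momentEqs k (k - 1) a α)
    (b : ℕ → ℝ) (bk1 : ℝ)
    (hzero : ∀ m : ℕ, 1 ≤ m → m ≤ k - 1 →
      deriv (fun x => (∑ s ∈ Finset.Icc 2 k, b s * Mhat s x) + bk1 * Mhat (k + 1) x) (α m) = 0) :
    deriv (fun x => (∑ s ∈ Finset.Icc 2 k, b s * Mhat s x) + bk1 * Mhat (k + 1) x) (α k) = 0 := by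
  choose P hPe hPd hP1 hP2 using Mhat_poly_s10
  set R : Polynomial ℝ := (∑ s ∈ Finset.Icc 2 k, Polynomial.C (b s) * P (s - 2))
    + Polynomial.C bk1 * P (k - 1) with hR
  have hfun : (fun x => (∑ s ∈ Finset.Icc 2 k, b s * Mhat s x) + bk1 * Mhat (k + 1) x)
      = fun x => R.eval x := by
    funext x
    rw [hR, Polynomial.eval_add, Polynomial.eval_finsetSum, Polynomial.eval_mul,
      Polynomial.eval_C, ← hPe, show k - 1 + 2 = k + 1 by omega]
    congr 1
    refine Finset.sum_congr rfl fun s hs => ?_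
    have := (Finset.mem_Icc.1 hs).1
    rw [Polynomial.eval_mul, Polynomial.eval_C, ← hPe, show s - 2 + 2 = s by omega]
  have hRd : R.natDegree ≤ k + 1 := by
    refine Polynomial.natDegree_add_le_of_degree_le ?_ ?_
    · refine Polynomial.natDegree_sum_le_of_forall_le _ _ fun s hs => ?_
      have := Finset.mem_Icc.1 hs
      have h2 := hPd (s - 2)
      exact (Polynomial.natDegree_C_mul_le _ _).trans (by omega)
    · have h2 := hPd (k - 1)
      exact (Polynomial.natDegree_C_mul_le _ _).trans (by omega)
  have hq := quad_exact k hk a α ha0 hak hm R hRd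
  have e1 : R.eval 1 = 0 := by simp [hR, Polynomial.eval_finsetSum, hP1]
  have e2 : R.eval (-1) = 0 := by simp [hR, Polynomial.eval_finsetSum, hP2]
  rw [hfun] at hzero ⊢
  simp only [Polynomial.deriv] at hzero ⊢
  rw [e1, e2, sub_zero, Finset.sum_eq_single_of_mem k (Finset.mem_Icc.2 ⟨by omega, le_rfl⟩)] at hq
  · have hpos := hamono (k - 1) k (by omega) le_rfl
    exact (mul_eq_zero.1 hq).resolve_left (by linarith)
  · intro s hs hne
    have := Finset.mem_Icc.1 hs
    rw [hzero s this.1 (by omega), mul_zero]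
end

section
/- Suppose the k-r-order moment equations hold with r = k. Let b*_2, ..., b*_k, b_{k+1} be reals and set R(x) = Σ_{s=2}^{k} b*_s M̂_s(x) + b_{k+1} M̂_{k+1}(x). If R'(α_m) = 0 for every m = 1, ..., k-1, then ∫_{-1}^{1} R(x) dx = 0. -/
open Finset

theorem aux_iter (p : Polynomial ℝ) (n : ℕ) :
    iteratedDeriv n (fun y => p.eval y) = fun y => ((Polynomial.derivative^[n]) p).eval y := by
  induction n with
  | zero => simp
  | succ n ih =>
    rw [iteratedDeriv_succ, ih]
    funext y
    rw [Polynomial.deriv, Function.iterate_succ_apply']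

theorem aux_Mhat (i : ℕ) : ∃ p : Polynomial ℝ, (∀ x, Mhat (i + 2) x = p.eval x) ∧
    p.natDegree ≤ i + 2 ∧ p.eval 1 = 0 ∧ p.eval (-1) = 0 := by
  obtain ⟨q, hq⟩ := Polynomial.pow_sub_dvd_iterate_derivative_pow
    ((Polynomial.X : Polynomial ℝ) ^ 2 - 1) (i + 1) i
  refine ⟨Polynomial.C (1 / ((2 : ℝ) ^ (i + 1) * (Nat.factorial (i + 1) : ℝ))) *
    (Polynomial.derivative^[i]) ((Polynomial.X ^ 2 - 1) ^ (i + 1)), ?_, ?_, ?_, ?_⟩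
  · intro x
    have h := congrFun (aux_iter ((Polynomial.X ^ 2 - 1) ^ (i + 1)) i) x
    simp only [Polynomial.eval_pow, Polynomial.eval_sub, Polynomial.eval_X,
      Polynomial.eval_one] at h
    simp only [Mhat, Polynomial.eval_mul, Polynomial.eval_C]
    rw [h]
  · refine (Polynomial.natDegree_C_mul_le _ _).trans ?_
    refine (Polynomial.natDegree_iterate_derivative _ _).trans ?_
    have h1 : ((Polynomial.X : Polynomial ℝ) ^ 2 - 1).natDegree ≤ 2 := by compute_degree
    have h2 := Polynomial.natDegree_pow_le (p := (Polynomial.X : Polynomial ℝ) ^ 2 - 1) (n := i + 1)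
    have h3 := Nat.mul_le_mul_left (i + 1) h1
    omega
  · rw [hq]; simp
  · rw [hq]; simp

theorem aux_quad (k : ℕ) (hk : 1 ≤ k) (a α : ℕ → ℝ) (ha0 : a 0 = -1) (hak : a k = 1)
    (hm : momentEqs k k a α) (q : Polynomial ℝ) (hq : q.natDegree ≤ k + 1) :
    ∫ x in (-1 : ℝ)..1, q.eval x = ∑ s ∈ Finset.Icc 1 k, (a s - a (s - 1)) * q.eval (α s) := by
  have hmon : ∀ j ∈ Finset.range (k + 2), ∫ x in (-1 : ℝ)..1, x ^ j =
      ∑ s ∈ Finset.Icc 1 k, (a s - a (s - 1)) * (α s) ^ j := by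
    intro j hj
    rw [Finset.mem_range] at hj
    cases j with
    | zero =>
      have : ∀ n : ℕ, ∑ s ∈ Finset.Icc 1 n, (a s - a (s - 1)) = a n - a 0 := by
        intro n
        induction n with
        | zero => simp
        | succ n ih => rw [Finset.sum_Icc_succ_top (by omega), ih]; simp
      simp only [pow_zero, mul_one]
      rw [this, ha0, hak]; simp
    | succ i =>
      rw [hm i (by omega), integral_pow]
      push_cast
      congr 1 <;> ring
  have he : ∀ x, q.eval x = ∑ j ∈ Finset.range (k + 2), q.coeff j * x ^ j :=
    fun x => Polynomial.eval_eq_sum_range' (by omega) x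
  simp only [he]
  rw [intervalIntegral.integral_finsetSum]
  · simp only [intervalIntegral.integral_const_mul, Finset.mul_sum]
    rw [Finset.sum_comm]
    refine Finset.sum_congr rfl fun j hj => ?_
    rw [hmon j hj, Finset.mul_sum]
    exact Finset.sum_congr rfl fun s _ => by ring
  · intro j _
    exact (by fun_prop : Continuous fun x : ℝ => q.coeff j * x ^ j).intervalIntegrable _ _

/-- Under the `k`-`k`-order moment equations, if
`R = Σ_{s=2}^{k} b*_s M̂_s + b_{k+1} M̂_{k+1}` satisfies `R'(α_m) = 0` for `m = 1, ..., k-1`,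
then `∫_{-1}^{1} R(x) dx = 0`. -/
theorem integral_R_eq_zero (k : ℕ) (hk : 1 ≤ k) (a α : ℕ → ℝ)
    (ha0 : a 0 = -1) (hak : a k = 1)
    (hamono : ∀ s t : ℕ, s < t → t ≤ k → a s < a t)
    (hinter : ∀ s : ℕ, 1 ≤ s → s ≤ k → a (s - 1) < α s ∧ α s < a s)
    (hm : momentEqs k k a α)
    (b : ℕ → ℝ) (bk1 : ℝ)
    (hzero : ∀ m : ℕ, 1 ≤ m → m ≤ k - 1 →
      deriv (fun x => (∑ s ∈ Finset.Icc 2 k, b s * Mhat s x) + bk1 * Mhat (k + 1) x) (α m) = 0) :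
    ∫ x in (-1 : ℝ)..1,
      ((∑ s ∈ Finset.Icc 2 k, b s * Mhat s x) + bk1 * Mhat (k + 1) x) = 0 := by
  choose P hP using aux_Mhat
  set p : Polynomial ℝ := (∑ s ∈ Finset.Icc 2 k, Polynomial.C (b s) * P (s - 2)) +
    Polynomial.C bk1 * P (k - 1) with hp
  have hR : (fun x => (∑ s ∈ Finset.Icc 2 k, b s * Mhat s x) + bk1 * Mhat (k + 1) x) =
      fun x => p.eval x := by
    funext x
    rw [hp, Polynomial.eval_add, Polynomial.eval_finsetSum]
    congr 1
    · refine Finset.sum_congr rfl fun s hs => ?_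
      rw [Finset.mem_Icc] at hs
      have := (hP (s - 2)).1 x
      rw [show s - 2 + 2 = s by omega] at this
      simp [this]
    · have := (hP (k - 1)).1 x
      rw [show k - 1 + 2 = k + 1 by omega] at this
      simp [this]
  have hdeg : p.natDegree ≤ k + 1 := by
    refine Polynomial.natDegree_add_le_of_degree_le ?_ ?_
    · refine Polynomial.natDegree_sum_le_of_forall_le _ _ fun s hs => ?_
      rw [Finset.mem_Icc] at hs
      refine (Polynomial.natDegree_C_mul_le _ _).trans ?_
      have := (hP (s - 2)).2.1
      omega
    · refine (Polynomial.natDegree_C_mul_le _ _).trans ?_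
      have := (hP (k - 1)).2.1
      omega
  have hp1 : p.eval 1 = 0 := by
    simp [hp, Polynomial.eval_finsetSum, (hP _).2.2.1]
  have hp2 : p.eval (-1) = 0 := by
    simp [hp, Polynomial.eval_finsetSum, (hP _).2.2.2]
  rw [hR] at hzero
  simp only [Polynomial.deriv] at hzero
  have hR2 := fun x => congrFun hR x
  simp only [hR2]
  clear hR hR2
  clear_value p
  have hd' : p.derivative.natDegree ≤ k := by
    have := Polynomial.natDegree_derivative_le p
    omega
  have hsum : ∀ q : Polynomial ℝ, (∀ m, 1 ≤ m → m ≤ k - 1 → q.eval (α m) = 0) →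
      q.natDegree ≤ k + 1 →
      ∫ x in (-1 : ℝ)..1, q.eval x = (a k - a (k - 1)) * q.eval (α k) := by
    intro q hq0 hq
    rw [aux_quad k hk a α ha0 hak hm q hq]
    refine Finset.sum_eq_single_of_mem k (by simp [hk]) fun s hs hsk => ?_
    rw [Finset.mem_Icc] at hs
    rw [hq0 s hs.1 (by omega), mul_zero]
  have hftc : ∀ q : Polynomial ℝ, ∫ x in (-1 : ℝ)..1, q.derivative.eval x =
      q.eval 1 - q.eval (-1) := by
    intro q
    exact intervalIntegral.integral_eq_sub_of_hasDerivAt (fun x _ => q.hasDerivAt x)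
      (q.derivative.continuous.intervalIntegrable _ _)
  have h1 := hsum p.derivative hzero (by omega)
  rw [hftc, hp1, hp2, sub_zero] at h1
  have hw : a k - a (k - 1) ≠ 0 := by
    have := hamono (k - 1) k (by omega) le_rfl
    exact (sub_pos.2 this).ne'
  have h2 : p.derivative.eval (α k) = 0 := by
    rcases mul_eq_zero.1 h1.symm with h | h
    · exact absurd h hw
    · exact h
  have h3 := hsum (Polynomial.X * p.derivative)
    (fun m h1 h2 => by simp [hzero m h1 h2])
    (Polynomial.natDegree_mul_le.trans (by rw [Polynomial.natDegree_X]; omega))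
  have h4 := hftc (Polynomial.X * p)
  simp only [Polynomial.derivative_mul, Polynomial.derivative_X, one_mul, Polynomial.eval_add,
    Polynomial.eval_mul, Polynomial.eval_X, hp1, hp2, h2, mul_zero, sub_zero] at h3 h4
  have hc : Continuous fun x : ℝ => x * p.derivative.eval x :=
    continuous_id.mul p.derivative.continuous
  rw [intervalIntegral.integral_add (p.continuous.intervalIntegrable _ _)
    (hc.intervalIntegrable _ _)] at h4
  linarith
end

section
/- There is a constant C depending only on k with the following property. For every rectangle K = [x₀, x₀+h_x] × [y₀, y₀+h_y] with 0 < h_x ≤ h and 0 < h_y ≤ h, and every real polynomial w(x,y) of degree at most k in each of the two variables separately, ‖w - Π¹_K w‖_{L²(K)} ≤ C · h · ( ‖∂_x w‖²_{L²(K)} + ‖∂_y w‖²_{L²(K)} )^{1/2}. -/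
open Finset

namespace LinInterp

open Polynomial in
/-- Inverse estimate on the reference interval. -/
lemma inv_unit (k : ℕ) : ∃ D : ℝ, 0 < D ∧ ∀ p : Polynomial ℝ, p.natDegree ≤ k →
    ∀ x ∈ Set.Icc (0:ℝ) 1, (p.eval x) ^ 2 ≤ D * ∫ t in (0:ℝ)..1, (p.eval t) ^ 2 := by
  let E : Type := Fin (k + 1) → ℝ
  let ev : E → ℝ → ℝ := fun c x => ∑ i : Fin (k + 1), c i * x ^ (i : ℕ)
  let F : E → ℝ := fun c => ∫ t in (0:ℝ)..1, (ev c t) ^ 2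
  have hevc : Continuous (Function.uncurry ev) := by
    simp only [ev, Function.uncurry_def]
    fun_prop
  have hF : Continuous F := by
    apply intervalIntegral.continuous_parametric_intervalIntegral_of_continuous'
    simp only [ev, Function.uncurry_def]
    fun_prop
  have hcs : ∀ c : E, Continuous (ev c) := fun c => by
    simp only [ev]; fun_prop
  have hpos : ∀ c : E, c ≠ 0 → 0 < F c := by
    intro c hc
    by_contra hneg
    have hz : ∀ x ∈ Set.Icc (0:ℝ) 1, ev c x = 0 := by
      intro x hx
      by_contra hx0
      apply hneg
      apply intervalIntegral.integral_pos (by norm_num) (((hcs c).pow 2).continuousOn)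
      · intro t _; exact sq_nonneg _
      · exact ⟨x, hx, lt_of_le_of_ne (sq_nonneg _) (Ne.symm (pow_ne_zero 2 hx0))⟩
    let p : Polynomial ℝ := ∑ i : Fin (k + 1), C (c i) * X ^ (i : ℕ)
    have hpe : ∀ x, p.eval x = ev c x := by
      intro x; simp [p, ev, eval_finset_sum]
    have hp0 : p = 0 := by
      apply Polynomial.eq_zero_of_infinite_isRoot
      refine (Set.Icc_infinite (zero_lt_one (α := ℝ))).mono ?_
      intro x hx
      simp only [Set.mem_setOf_eq, IsRoot.def, hpe]
      exact hz x hx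
    apply hc
    funext i
    have : p.coeff (i : ℕ) = c i := by
      simp only [p, finset_sum_coeff, coeff_C_mul, coeff_X_pow]
      rw [Finset.sum_eq_single i]
      · simp
      · intro j _ hj
        have : (i : ℕ) ≠ (j : ℕ) := fun h => hj (Fin.ext h.symm)
        simp [this]
      · simp
    rw [← this, hp0]; rfl
  have hcomp : IsCompact (Metric.sphere (0 : E) 1) := isCompact_sphere _ _
  have hne : (Metric.sphere (0 : E) 1).Nonempty := NormedSpace.sphere_nonempty.mpr zero_le_one
  obtain ⟨c0, hc0, hmin⟩ := hcomp.exists_isMinOn hne hF.continuousOn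
  have hm : 0 < F c0 := hpos c0 (by
    rintro rfl; simp at hc0)
  have hscale : ∀ (r : ℝ) (c : E), F (r • c) = r ^ 2 * F c := by
    intro r c
    simp only [F]
    rw [← intervalIntegral.integral_const_mul]
    congr 1; funext t
    have : ev (r • c) t = r * ev c t := by
      simp only [ev, Finset.mul_sum]
      refine Finset.sum_congr rfl fun i _ => ?_
      change r * c i * t ^ (i : ℕ) = _
      ring
    rw [this]; ring
  have hlow : ∀ c : E, F c0 * ‖c‖ ^ 2 ≤ F c := by
    intro c
    by_cases hc : c = 0
    · subst hc
      have := hscale 0 (0:E)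
      simp at this
      simp [this]
    · have hn : 0 < ‖c‖ := norm_pos_iff.mpr hc
      have h1 : F c0 ≤ F (‖c‖⁻¹ • c) := by
        apply hmin
        simp [norm_smul, hn.ne']
      rw [hscale] at h1
      have h2 := mul_le_mul_of_nonneg_right h1 (sq_nonneg ‖c‖)
      calc _ ≤ _ := h2
        _ = F c := by field_simp
  have hup : ∀ (c : E), ∀ x ∈ Set.Icc (0:ℝ) 1, |ev c x| ≤ (k + 1) * ‖c‖ := by
    intro c x hx
    calc |ev c x| ≤ ∑ i : Fin (k + 1), |c i * x ^ (i : ℕ)| := Finset.abs_sum_le_sum_abs _ _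
      _ ≤ ∑ i : Fin (k + 1), ‖c‖ := by
        apply Finset.sum_le_sum
        intro i _
        rw [abs_mul]
        have h1 : |c i| ≤ ‖c‖ := norm_le_pi_norm c i
        have h2 : |x ^ (i : ℕ)| ≤ 1 := by
          rw [abs_of_nonneg (pow_nonneg hx.1 _)]
          exact pow_le_one₀ hx.1 hx.2
        calc _ ≤ ‖c‖ * 1 := mul_le_mul h1 h2 (abs_nonneg _) (norm_nonneg _)
          _ = _ := mul_one _
      _ = _ := by simp
  refine ⟨(k + 1) ^ 2 / F c0, by positivity, ?_⟩
  intro p hp x hx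
  let c : E := fun i => p.coeff i
  have hpe : ∀ t, p.eval t = ev c t := by
    intro t
    rw [eval_eq_sum_range' (Nat.lt_succ_of_le hp), Finset.sum_range]
  simp only [hpe]
  change _ ≤ _ * F c
  have h1 := hup c x hx
  have h2 : (ev c x) ^ 2 ≤ ((k + 1) * ‖c‖) ^ 2 := by
    rw [← sq_abs]; gcongr
  have h3 := hlow c
  calc _ ≤ _ := h2
    _ = (k + 1) ^ 2 / F c0 * (F c0 * ‖c‖ ^ 2) := by field_simp
    _ ≤ _ := by gcongr

open Polynomial in
lemma inv_interval (k : ℕ) : ∃ D : ℝ, 0 < D ∧ ∀ p : Polynomial ℝ, p.natDegree ≤ k →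
    ∀ a h : ℝ, 0 < h → ∀ x ∈ Set.Icc a (a + h),
      (p.eval x) ^ 2 ≤ D / h * ∫ t in a..(a + h), (p.eval t) ^ 2 := by
  obtain ⟨D, hD, H⟩ := inv_unit k
  refine ⟨D, hD, ?_⟩
  intro p hp a h hh x hx
  let q : Polynomial ℝ := p.comp (C h * X + C a)
  have hq : q.natDegree ≤ k := by
    refine natDegree_comp_le.trans ?_
    calc _ ≤ k * 1 := Nat.mul_le_mul hp natDegree_linear_le
      _ = k := mul_one _
  have hqe : ∀ t, q.eval t = p.eval (h * t + a) := by intro t; simp [q]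
  have h1 := H q hq ((x - a) / h) ⟨div_nonneg (by linarith [hx.1]) hh.le,
    (div_le_one hh).mpr (by linarith [hx.2])⟩
  simp only [hqe] at h1
  rw [intervalIntegral.integral_comp_mul_add (fun t => (p.eval t) ^ 2) hh.ne' a] at h1
  have e1 : h * ((x - a) / h) + a = x := by field_simp; ring
  rw [e1] at h1
  have e2 : h * 0 + a = a := by ring
  have e3 : h * 1 + a = a + h := by ring
  rw [e2, e3, smul_eq_mul] at h1
  rw [div_eq_mul_inv, mul_assoc]
  exact h1

lemma inv_rect (k : ℕ) : ∃ D : ℝ, 0 < D ∧ ∀ g : ℝ → ℝ → ℝ,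
    Continuous (Function.uncurry g) →
    (∀ y, ∃ p : Polynomial ℝ, p.natDegree ≤ k ∧ ∀ s, g s y = p.eval s) →
    (∀ x, ∃ p : Polynomial ℝ, p.natDegree ≤ k ∧ ∀ t, g x t = p.eval t) →
    ∀ a b hx hy : ℝ, 0 < hx → 0 < hy → ∀ x ∈ Set.Icc a (a + hx), ∀ y ∈ Set.Icc b (b + hy),
      (g x y) ^ 2 ≤ D / (hx * hy) * ∫ s in a..(a + hx), ∫ t in b..(b + hy), (g s t) ^ 2 := by
  obtain ⟨D, hD, H⟩ := inv_interval k
  refine ⟨D * D, by positivity, ?_⟩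
  intro g hg h1 h2 a b hx hy hhx hhy x hxm y hym
  have step1 : (g x y) ^ 2 ≤ D / hx * ∫ s in a..(a + hx), (g s y) ^ 2 := by
    obtain ⟨p, hp, he⟩ := h1 y
    simp only [he]
    exact H p hp a hx hhx x hxm
  have step2 : ∀ s, (g s y) ^ 2 ≤ D / hy * ∫ t in b..(b + hy), (g s t) ^ 2 := by
    intro s
    obtain ⟨p, hp, he⟩ := h2 s
    simp only [he]
    exact H p hp b hy hhy y hym
  have cont : Continuous fun s => ∫ t in b..(b + hy), (g s t) ^ 2 := by
    apply intervalIntegral.continuous_parametric_intervalIntegral_of_continuous'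
    exact hg.pow 2
  have cont0 : Continuous fun s => (g s y) ^ 2 :=
    (hg.comp (by fun_prop : Continuous fun s : ℝ => (s, y))).pow 2
  have step3 : ∫ s in a..(a + hx), (g s y) ^ 2 ≤
      ∫ s in a..(a + hx), D / hy * ∫ t in b..(b + hy), (g s t) ^ 2 := by
    apply intervalIntegral.integral_mono_on (by linarith) (cont0.intervalIntegrable _ _)
      ((continuous_const.mul cont).intervalIntegrable _ _)
    intro s _
    exact step2 s
  rw [intervalIntegral.integral_const_mul] at step3
  calc _ ≤ _ := step1
    _ ≤ D / hx * (D / hy * ∫ s in a..(a + hx), ∫ t in b..(b + hy), (g s t) ^ 2) := by gcongr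
    _ = _ := by field_simp

lemma mvt (f f' : ℝ → ℝ) (hf : ∀ x, HasDerivAt f (f' x) x) (a h M : ℝ) (hM : 0 ≤ M)
    (hb : ∀ x ∈ Set.Icc a (a + h), |f' x| ≤ M) (x : ℝ) (hx : x ∈ Set.Icc a (a + h)) :
    |f x - f a| ≤ M * h := by
  have h0 : a ≤ a + h := hx.1.trans hx.2
  have := (convex_Icc a (a + h)).norm_image_sub_le_of_norm_hasDerivWithin_le
    (fun t _ => (hf t).hasDerivWithinAt) (fun t ht => hb t ht)
    (Set.left_mem_Icc.mpr h0) hx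
  refine this.trans ?_
  rw [Real.norm_eq_abs, abs_of_nonneg (by linarith [hx.1])]
  exact mul_le_mul_of_nonneg_left (by linarith [hx.2]) hM

open Polynomial in
lemma sec (k : ℕ) (d : ℕ → ℝ) : ∃ p : Polynomial ℝ, p.natDegree ≤ k ∧
    ∀ s, ∑ i ∈ Finset.range (k + 1), d i * s ^ i = p.eval s := by
  refine ⟨∑ i ∈ Finset.range (k + 1), C (d i) * X ^ i, ?_, ?_⟩
  · apply natDegree_sum_le_of_forall_le
    intro i hi
    exact (natDegree_C_mul_X_pow_le _ _).trans (Nat.lt_succ_iff.mp (Finset.mem_range.mp hi))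
  · intro s; simp [eval_finset_sum]

lemma sec' (k : ℕ) (d : ℕ → ℝ) : ∃ p : Polynomial ℝ, p.natDegree ≤ k ∧
    ∀ s, ∑ i ∈ Finset.range (k + 1), d i * (i * s ^ (i - 1)) = p.eval s := by
  obtain ⟨p, hp, he⟩ := sec k d
  refine ⟨p.derivative, (Polynomial.natDegree_derivative_le p).trans (by omega), ?_⟩
  intro s
  have h1 : HasDerivAt (fun s => ∑ i ∈ Finset.range (k + 1), d i * s ^ i)
      (∑ i ∈ Finset.range (k + 1), d i * (i * s ^ (i - 1))) s :=
    HasDerivAt.fun_sum fun i _ => (hasDerivAt_pow i s).const_mul (d i)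
  have h2 := p.hasDerivAt s
  rw [funext he] at h1
  exact h1.unique h2

end LinInterp

open LinInterp in
/-- There is a constant `C` depending only on `k` such that for every rectangle
`K = [x₀, x₀+h_x] × [y₀, y₀+h_y]` with `0 < h_x ≤ h`, `0 < h_y ≤ h` and every bivariate
polynomial `w` of degree at most `k` in each variable separately,
`‖w - Π¹_K w‖_{L²(K)} ≤ C h (‖∂ₓ w‖²_{L²(K)} + ‖∂_y w‖²_{L²(K)})^{1/2}`, where
`Π¹_K w (x,y) = w(x₀,y₀) + (w(x₀+h_x,y₀) - w(x₀,y₀))(x-x₀)/h_x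
  + (w(x₀,y₀+h_y) - w(x₀,y₀))(y-y₀)/h_y`. -/
theorem linear_interp_L2_estimate (k : ℕ) (hk : 1 ≤ k) :
    ∃ C : ℝ, 0 < C ∧
      ∀ (h x₀ y₀ hx hy : ℝ), 0 < hx → hx ≤ h → 0 < hy → hy ≤ h →
      ∀ (c : ℕ → ℕ → ℝ) (w : ℝ → ℝ → ℝ),
        (w = fun x y =>
          ∑ i ∈ Finset.range (k + 1), ∑ j ∈ Finset.range (k + 1), c i j * x ^ i * y ^ j) →
        Real.sqrt (∫ x in x₀..(x₀ + hx), ∫ y in y₀..(y₀ + hy),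
            (w x y - (w x₀ y₀ + (w (x₀ + hx) y₀ - w x₀ y₀) * (x - x₀) / hx
              + (w x₀ (y₀ + hy) - w x₀ y₀) * (y - y₀) / hy)) ^ 2)
          ≤ C * h * Real.sqrt
              ((∫ x in x₀..(x₀ + hx), ∫ y in y₀..(y₀ + hy),
                  (deriv (fun s => w s y) x) ^ 2)
                + ∫ x in x₀..(x₀ + hx), ∫ y in y₀..(y₀ + hy),
                  (deriv (fun t => w x t) y) ^ 2) := by
  obtain ⟨D, hD, H⟩ := inv_rect k
  refine ⟨Real.sqrt (8 * D), by positivity, ?_⟩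
  intro h x₀ y₀ hx hy hx0 hxh hy0 hyh c w hw
  have hh : 0 < h := hx0.trans_le hxh
  let gx : ℝ → ℝ → ℝ := fun x y => ∑ i ∈ Finset.range (k + 1), ∑ j ∈ Finset.range (k + 1),
    c i j * (i * x ^ (i - 1)) * y ^ j
  let gy : ℝ → ℝ → ℝ := fun x y => ∑ i ∈ Finset.range (k + 1), ∑ j ∈ Finset.range (k + 1),
    c i j * x ^ i * (j * y ^ (j - 1))
  have hdx : ∀ y x, HasDerivAt (fun s => w s y) (gx x y) x := by
    intro y x
    rw [hw]
    exact HasDerivAt.fun_sum fun i _ => HasDerivAt.fun_sum fun j _ =>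
      ((hasDerivAt_pow i x).const_mul (c i j)).mul_const (y ^ j)
  have hdy : ∀ x y, HasDerivAt (fun t => w x t) (gy x y) y := by
    intro x y
    rw [hw]
    exact HasDerivAt.fun_sum fun i _ => HasDerivAt.fun_sum fun j _ =>
      (hasDerivAt_pow j y).const_mul (c i j * x ^ i)
  have hcx : Continuous (Function.uncurry gx) := by
    simp only [gx, Function.uncurry_def]; fun_prop
  have hcy : Continuous (Function.uncurry gy) := by
    simp only [gy, Function.uncurry_def]; fun_prop
  have hX := H gx hcx
    (fun y => by
      obtain ⟨p, hp, he⟩ := sec' k (fun i => ∑ j ∈ Finset.range (k + 1), c i j * y ^ j)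
      refine ⟨p, hp, fun s => ?_⟩
      rw [← he]
      refine Finset.sum_congr rfl fun i _ => ?_
      rw [Finset.sum_mul]
      exact Finset.sum_congr rfl fun j _ => by ring)
    (fun x => by
      obtain ⟨p, hp, he⟩ := sec k
        (fun j => ∑ i ∈ Finset.range (k + 1), c i j * (i * x ^ (i - 1)))
      refine ⟨p, hp, fun s => ?_⟩
      rw [← he]
      simp only [gx]
      rw [Finset.sum_comm]
      refine Finset.sum_congr rfl fun i _ => ?_
      rw [Finset.sum_mul])
    x₀ y₀ hx hy hx0 hy0
  have hY := H gy hcy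
    (fun y => by
      obtain ⟨p, hp, he⟩ := sec k
        (fun i => ∑ j ∈ Finset.range (k + 1), c i j * (j * y ^ (j - 1)))
      refine ⟨p, hp, fun s => ?_⟩
      rw [← he]
      refine Finset.sum_congr rfl fun i _ => ?_
      rw [Finset.sum_mul]
      exact Finset.sum_congr rfl fun j _ => by ring)
    (fun x => by
      obtain ⟨p, hp, he⟩ := sec' k (fun j => ∑ i ∈ Finset.range (k + 1), c i j * x ^ i)
      refine ⟨p, hp, fun s => ?_⟩
      rw [← he]
      simp only [gy]
      rw [Finset.sum_comm]
      refine Finset.sum_congr rfl fun i _ => ?_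
      rw [Finset.sum_mul])
    x₀ y₀ hx hy hx0 hy0
  simp only [fun x y => (hdx y x).deriv, fun x y => (hdy x y).deriv]
  set A := ∫ x in x₀..(x₀ + hx), ∫ y in y₀..(y₀ + hy), (gx x y) ^ 2 with hA
  set B := ∫ x in x₀..(x₀ + hx), ∫ y in y₀..(y₀ + hy), (gy x y) ^ 2 with hB
  have hx00 : x₀ ∈ Set.Icc x₀ (x₀ + hx) := ⟨le_rfl, by linarith⟩
  have hy00 : y₀ ∈ Set.Icc y₀ (y₀ + hy) := ⟨le_rfl, by linarith⟩
  have hx11 : x₀ + hx ∈ Set.Icc x₀ (x₀ + hx) := ⟨by linarith, le_rfl⟩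
  have hy11 : y₀ + hy ∈ Set.Icc y₀ (y₀ + hy) := ⟨by linarith, le_rfl⟩
  have hA0 : 0 ≤ D / (hx * hy) * A := (sq_nonneg _).trans (hX x₀ hx00 y₀ hy00)
  have hB0 : 0 ≤ D / (hx * hy) * B := (sq_nonneg _).trans (hY x₀ hx00 y₀ hy00)
  obtain ⟨M, hM0, hM⟩ : ∃ M : ℝ, 0 ≤ M ∧ M ^ 2 = D / (hx * hy) * A :=
    ⟨_, Real.sqrt_nonneg _, Real.sq_sqrt hA0⟩
  obtain ⟨N, hN0, hN⟩ : ∃ N : ℝ, 0 ≤ N ∧ N ^ 2 = D / (hx * hy) * B :=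
    ⟨_, Real.sqrt_nonneg _, Real.sq_sqrt hB0⟩
  rw [← hM] at hX
  rw [← hN] at hY
  have mx : ∀ x ∈ Set.Icc x₀ (x₀ + hx), ∀ y ∈ Set.Icc y₀ (y₀ + hy),
      |w x y - w x₀ y| ≤ M * h := fun x hxm y hym =>
    (mvt (fun s => w s y) (fun s => gx s y) (hdx y) x₀ hx M hM0
      (fun s hs => abs_le_of_sq_le_sq (hX s hs y hym) hM0) x hxm).trans
      (mul_le_mul_of_nonneg_left hxh hM0)
  have my : ∀ x ∈ Set.Icc x₀ (x₀ + hx), ∀ y ∈ Set.Icc y₀ (y₀ + hy),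
      |w x y - w x y₀| ≤ N * h := fun x hxm y hym =>
    (mvt (fun t => w x t) (fun t => gy x t) (hdy x) y₀ hy N hN0
      (fun s hs => abs_le_of_sq_le_sq (hY x hxm s hs) hN0) y hym).trans
      (mul_le_mul_of_nonneg_left hyh hN0)
  have pt : ∀ x ∈ Set.Icc x₀ (x₀ + hx), ∀ y ∈ Set.Icc y₀ (y₀ + hy),
      (w x y - (w x₀ y₀ + (w (x₀ + hx) y₀ - w x₀ y₀) * (x - x₀) / hx
              + (w x₀ (y₀ + hy) - w x₀ y₀) * (y - y₀) / hy)) ^ 2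
        ≤ 8 * h ^ 2 * (M ^ 2 + N ^ 2) := by
    intro x hxm y hym
    have frac : ∀ u s t Q : ℝ, |u| ≤ Q → 0 < t → 0 ≤ s → s ≤ t → |u * s / t| ≤ Q := by
      intro u s t Q hu ht hs hst
      rw [mul_div_assoc, abs_mul, abs_of_nonneg (div_nonneg hs ht.le)]
      exact (mul_le_of_le_one_right (abs_nonneg _) ((div_le_one ht).mpr hst)).trans hu
    have f1 := frac _ (x - x₀) hx _ (mx _ hx11 _ hy00) hx0 (by linarith [hxm.1])
      (by linarith [hxm.2])
    have f2 := frac _ (y - y₀) hy _ (my _ hx00 _ hy11) hy0 (by linarith [hym.1])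
      (by linarith [hym.2])
    have f3 := mx x hxm y₀ hy00
    have f4 := my x hxm y hym
    have key : |w x y - (w x₀ y₀ + (w (x₀ + hx) y₀ - w x₀ y₀) * (x - x₀) / hx
              + (w x₀ (y₀ + hy) - w x₀ y₀) * (y - y₀) / hy)| ≤ 2 * h * (M + N) := by
      rw [abs_le] at f1 f2 f3 f4 ⊢
      constructor <;> linarith [f1.1, f1.2, f2.1, f2.2, f3.1, f3.2, f4.1, f4.2]
    rw [← sq_abs]
    calc _ ≤ (2 * h * (M + N)) ^ 2 := by gcongr
      _ ≤ _ := by nlinarith [mul_nonneg (sq_nonneg h) (sq_nonneg (M - N))]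
  have hint : (∫ x in x₀..(x₀ + hx), ∫ y in y₀..(y₀ + hy),
            (w x y - (w x₀ y₀ + (w (x₀ + hx) y₀ - w x₀ y₀) * (x - x₀) / hx
              + (w x₀ (y₀ + hy) - w x₀ y₀) * (y - y₀) / hy)) ^ 2)
        ≤ 8 * h ^ 2 * (M ^ 2 + N ^ 2) * hy * hx := by
    have ax : |x₀ + hx - x₀| = hx := by rw [add_sub_cancel_left, abs_of_pos hx0]
    have ay : |y₀ + hy - y₀| = hy := by rw [add_sub_cancel_left, abs_of_pos hy0]
    refine (le_abs_self _).trans ?_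
    rw [← Real.norm_eq_abs]
    conv_rhs => rw [← ax]
    apply intervalIntegral.norm_integral_le_of_norm_le_const
    intro x hxm
    rw [Set.uIoc_of_le (by linarith)] at hxm
    conv_rhs => rw [← ay]
    apply intervalIntegral.norm_integral_le_of_norm_le_const
    intro y hym
    rw [Set.uIoc_of_le (by linarith)] at hym
    rw [Real.norm_eq_abs, abs_of_nonneg (sq_nonneg _)]
    exact pt x (Set.Ioc_subset_Icc_self hxm) y (Set.Ioc_subset_Icc_self hym)
  have e : 8 * h ^ 2 * (M ^ 2 + N ^ 2) * hy * hx = (8 * D) * h ^ 2 * (A + B) := by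
    rw [hM, hN]; field_simp
  rw [e] at hint
  calc _ ≤ Real.sqrt ((8 * D) * h ^ 2 * (A + B)) := Real.sqrt_le_sqrt hint
    _ = _ := by
      rw [Real.sqrt_mul (by positivity), Real.sqrt_mul (by positivity), Real.sqrt_sq hh.le]
end

section
/- Let k ≥ 1 be an integer and let u : ℝ² → ℝ be of class C^{k+2}. Let x₀ < x₁ and y₀ < y₁ be reals, h_x = x₁ - x₀, h_y = y₁ - y₀, and write p(x̂) = (h_x x̂ + x₀ + x₁)/2, q(ŷ) = (h_y ŷ + y₀ + y₁)/2. Then (h_y/2)·((2k+1)/4)·∫_{-1}^{1} [∂_y u(x₁, q(ŷ)) − ∂_y u(x₀, q(ŷ))] · L_k(ŷ) dŷ = (h_x/2)·(h_y/2)^{k+1}·((2k+1)(-1)^k/(2^{k+2} k!))·∫_{-1}^{1}∫_{-1}^{1} (∂^{k+2}u/∂x∂y^{k+1})(p(x̂), q(ŷ)) · (ŷ²-1)^k dx̂ dŷ, where ∂^{k+2}u/∂x∂y^{k+1} is the partial derivative of u taken once in the first variable and k+1 times in the second variable. -/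
/-- The `k`-th Legendre polynomial via the Rodrigues formula:
`L_k(t) = (1/(2^k k!)) dᵏ/dtᵏ (t²-1)ᵏ`. -/
noncomputable def legendreP (k : ℕ) (t : ℝ) : ℝ :=
  (1 / ((2 : ℝ) ^ k * (Nat.factorial k : ℝ))) *
    iteratedDeriv k (fun s => (s ^ 2 - 1) ^ k) t

lemma aux_W_iter (p : Polynomial ℝ) (j : ℕ) :
    iteratedDeriv j (fun s => p.eval s) = fun s => (Polynomial.derivative^[j] p).eval s := by
  induction j with
  | zero => simp
  | succ j ih =>
    rw [iteratedDeriv_succ, ih]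
    funext s
    rw [Polynomial.deriv, Function.iterate_succ_apply']

lemma aux_W_zero (k j : ℕ) (hj : j < k) (a : ℝ) (ha : a ^ 2 = 1) :
    (Polynomial.derivative^[j] ((Polynomial.X ^ 2 - 1 : Polynomial ℝ) ^ k)).eval a = 0 := by
  have h1 : (Polynomial.X - Polynomial.C a) ∣ (Polynomial.X ^ 2 - 1 : Polynomial ℝ) := by
    rw [Polynomial.dvd_iff_isRoot]; simp [ha]
  have h2 := Polynomial.pow_sub_dvd_iterate_derivative_of_pow_dvd j (pow_dvd_pow_of_dvd h1 k)
  have h3 := (dvd_pow_self (Polynomial.X - Polynomial.C a) (by omega : k - j ≠ 0)).trans h2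
  rw [Polynomial.dvd_iff_isRoot] at h3
  exact h3

lemma aux_ibp (k : ℕ) (c d : ℝ) : ∀ (j : ℕ), j ≤ k → ∀ (g : ℕ → ℝ → ℝ),
    (∀ i < j, ∀ t, HasDerivAt (g i) (g (i + 1) t) t) → (∀ i ≤ j, Continuous (g i)) →
    ∫ y in (-1 : ℝ)..1, g 0 (c * y + d) *
        (Polynomial.derivative^[j] ((Polynomial.X ^ 2 - 1 : Polynomial ℝ) ^ k)).eval y
      = (-c) ^ j * ∫ y in (-1 : ℝ)..1, g j (c * y + d) * (y ^ 2 - 1) ^ k := by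
  intro j
  induction j with
  | zero => intro _ g _ _; simp
  | succ j ih =>
    intro hj g hg hc
    have h1 := ih (by omega) (fun i => g (i + 1)) (fun i hi => hg (i + 1) (by omega))
      (fun i hi => hc (i + 1) (by omega))
    have hd : ∀ y : ℝ, HasDerivAt (fun y => g 0 (c * y + d)) (g 1 (c * y + d) * c) y := by
      intro y
      have h2 : HasDerivAt (fun y : ℝ => c * y + d) c y := by
        simpa using ((hasDerivAt_id y).const_mul c).add_const d
      exact (hg 0 (by omega) (c * y + d)).comp y h2
    have hc1 : Continuous (g 1) := hc 1 (by omega)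
    have h3 := intervalIntegral.integral_mul_deriv_eq_deriv_mul (a := (-1 : ℝ)) (b := 1)
      (fun y _ => hd y)
      (fun y _ => (Polynomial.derivative^[j]
        ((Polynomial.X ^ 2 - 1 : Polynomial ℝ) ^ k)).hasDerivAt y)
      (Continuous.intervalIntegrable (by fun_prop) _ _)
      (Continuous.intervalIntegrable (Polynomial.continuous _) _ _)
    simp only [Function.iterate_succ_apply']
    rw [h3, aux_W_zero k j (by omega) 1 (by norm_num),
      aux_W_zero k j (by omega) (-1) (by norm_num)]
    simp only [zero_add] at h1
    have h4 : ∀ y : ℝ, g 1 (c * y + d) * c * (Polynomial.derivative^[j]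
        ((Polynomial.X ^ 2 - 1 : Polynomial ℝ) ^ k)).eval y
        = c * (g 1 (c * y + d) * (Polynomial.derivative^[j]
        ((Polynomial.X ^ 2 - 1 : Polynomial ℝ) ^ k)).eval y) := fun y => by ring
    simp only [h4]
    rw [intervalIntegral.integral_const_mul, h1]
    ring

lemma aux_iter_contDiff (u : ℝ → ℝ → ℝ) : ∀ (j n : ℕ),
    ContDiff ℝ ((n + j : ℕ) : ℕ∞) (Function.uncurry u) →
    ContDiff ℝ (n : ℕ∞) (fun z : ℝ × ℝ => iteratedDeriv j (fun t => u z.1 t) z.2) := by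
  intro j
  induction j with
  | zero => intro n h; simpa [Function.uncurry_def] using h
  | succ j ih =>
    intro n h
    have h1 := ih (n + 1) (by rwa [show n + 1 + j = n + (j + 1) by omega])
    set F := fun z : ℝ × ℝ => iteratedDeriv j (fun t => u z.1 t) z.2 with hF
    have h2 : (fun z : ℝ × ℝ => iteratedDeriv (j + 1) (fun t => u z.1 t) z.2)
        = fun z => fderiv ℝ F z (0, 1) := by
      funext z
      rw [iteratedDeriv_succ]
      have hdF : HasFDerivAt F (fderiv ℝ F z) (z.1, z.2) :=
        (h1.differentiable (by simp) z).hasFDerivAt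
      have h5 : HasDerivAt (fun t : ℝ => (z.1, t)) ((0 : ℝ), (1 : ℝ)) z.2 :=
        (hasDerivAt_const _ _).prodMk (hasDerivAt_id _)
      exact (hdF.comp_hasDerivAt z.2 h5).deriv
    rw [h2]
    exact (h1.fderiv_right (m := (n : ℕ∞)) (by norm_cast)).clm_apply contDiff_const

/-- Integration by parts identity for the M-decomposition coefficient `b_{1,k+1}`:
`(h_y/2)((2k+1)/4) ∫_{-1}^1 [∂_y u(x₁, q(ŷ)) − ∂_y u(x₀, q(ŷ))] L_k(ŷ) dŷ
 = (h_x/2)(h_y/2)^{k+1} ((2k+1)(-1)^k/(2^{k+2} k!))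
   ∫_{-1}^1 ∫_{-1}^1 (∂^{k+2}u/∂x∂y^{k+1})(p(x̂), q(ŷ)) (ŷ²-1)^k dx̂ dŷ`. -/
theorem bcoef_double_integral_identity (k : ℕ) (hk : 1 ≤ k) (u : ℝ → ℝ → ℝ)
    (hu : ContDiff ℝ (k + 2 : ℕ) (Function.uncurry u))
    (x₀ x₁ y₀ y₁ : ℝ) (hx : x₀ < x₁) (hy : y₀ < y₁) :
    ((y₁ - y₀) / 2) * ((2 * (k : ℝ) + 1) / 4) *
      (∫ yh in (-1 : ℝ)..1,
        (deriv (fun t => u x₁ t) (((y₁ - y₀) * yh + y₀ + y₁) / 2)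
          - deriv (fun t => u x₀ t) (((y₁ - y₀) * yh + y₀ + y₁) / 2)) * legendreP k yh)
    = ((x₁ - x₀) / 2) * ((y₁ - y₀) / 2) ^ (k + 1) *
        (((2 * (k : ℝ) + 1) * (-1 : ℝ) ^ k) / ((2 : ℝ) ^ (k + 2) * (Nat.factorial k : ℝ))) *
        ∫ yh in (-1 : ℝ)..1, ∫ xh in (-1 : ℝ)..1,
          deriv (fun s => iteratedDeriv (k + 1) (fun t => u s t)
              (((y₁ - y₀) * yh + y₀ + y₁) / 2)) (((x₁ - x₀) * xh + x₀ + x₁) / 2)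
            * (yh ^ 2 - 1) ^ k := by
  have hF : ∀ j n : ℕ, n + j = k + 2 →
      ContDiff ℝ (n : ℕ∞) (fun z : ℝ × ℝ => iteratedDeriv j (fun t => u z.1 t) z.2) := by
    intro j n h
    refine aux_iter_contDiff u j n ?_
    rw [h]; exact_mod_cast hu
  have hline : ∀ j ≤ k + 1, ∀ x, ContDiff ℝ 1 (iteratedDeriv j (fun t => u x t)) := by
    intro j hj x
    have h1 := (hF j (k + 2 - j) (by omega)).comp (contDiff_const.prodMk contDiff_id :
      ContDiff ℝ _ (fun t : ℝ => (x, t)))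
    exact h1.of_le (by norm_cast; omega)
  have hline2 : ∀ y, ContDiff ℝ 1 (fun s => iteratedDeriv (k + 1) (fun t => u s t) y) := by
    intro y
    have h1 := (hF (k + 1) 1 (by omega)).comp (contDiff_id.prodMk contDiff_const :
      ContDiff ℝ _ (fun s : ℝ => (s, y)))
    exact h1.of_le (by norm_cast)
  -- inner integral
  have hinner : ∀ yh : ℝ, ((x₁ - x₀) / 2) * ∫ xh in (-1 : ℝ)..1,
          deriv (fun s => iteratedDeriv (k + 1) (fun t => u s t)
              (((y₁ - y₀) * yh + y₀ + y₁) / 2)) (((x₁ - x₀) * xh + x₀ + x₁) / 2)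
            * (yh ^ 2 - 1) ^ k
      = (iteratedDeriv (k + 1) (fun t => u x₁ t) (((y₁ - y₀) * yh + y₀ + y₁) / 2)
        - iteratedDeriv (k + 1) (fun t => u x₀ t) (((y₁ - y₀) * yh + y₀ + y₁) / 2))
        * (yh ^ 2 - 1) ^ k := by
    intro yh
    have h1 := hline2 (((y₁ - y₀) * yh + y₀ + y₁) / 2)
    set φ := fun s => iteratedDeriv (k + 1) (fun t => u s t) (((y₁ - y₀) * yh + y₀ + y₁) / 2)
      with hφ
    have hp : ∀ x : ℝ, HasDerivAt (fun xh : ℝ => ((x₁ - x₀) * xh + x₀ + x₁) / 2)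
        ((x₁ - x₀) / 2) x := by
      intro x
      simpa using ((((hasDerivAt_id x).const_mul (x₁ - x₀)).add_const x₀).add_const x₁).div_const 2
    have hdc : Continuous (deriv φ) := h1.continuous_deriv (by simp)
    have h2 := intervalIntegral.integral_eq_sub_of_hasDerivAt (a := (-1 : ℝ)) (b := 1)
      (f := fun xh => φ (((x₁ - x₀) * xh + x₀ + x₁) / 2))
      (f' := fun xh => deriv φ (((x₁ - x₀) * xh + x₀ + x₁) / 2) * ((x₁ - x₀) / 2))
      (fun x _ => ((h1.differentiable (by simp) _).hasDerivAt).comp x (hp x))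
      (Continuous.intervalIntegrable (by fun_prop) _ _)
    rw [intervalIntegral.integral_mul_const] at h2
    rw [intervalIntegral.integral_mul_const]
    have e1 : ((x₁ - x₀) * 1 + x₀ + x₁) / 2 = x₁ := by ring
    have e2 : ((x₁ - x₀) * (-1) + x₀ + x₁) / 2 = x₀ := by ring
    simp only [e1, e2] at h2
    change _ = (φ x₁ - φ x₀) * _
    rw [← h2]; ring
  have hibp := aux_ibp k ((y₁ - y₀) / 2) ((y₀ + y₁) / 2) k le_rfl
    (fun i t => iteratedDeriv (i + 1) (fun t => u x₁ t) t
      - iteratedDeriv (i + 1) (fun t => u x₀ t) t)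
    (by
      intro i hi t
      have h : ∀ x, HasDerivAt (iteratedDeriv (i + 1) (fun t => u x t))
          (iteratedDeriv (i + 1 + 1) (fun t => u x t) t) t := by
        intro x
        rw [iteratedDeriv_succ (n := i + 1)]
        exact ((hline (i + 1) (by omega) x).differentiable (by simp) t).hasDerivAt
      exact (h x₁).sub (h x₀))
    (by
      intro i hi
      exact (hline (i + 1) (by omega) x₁).continuous.sub (hline (i + 1) (by omega) x₀).continuous)
  have hL : ∀ y : ℝ, legendreP k y = (1 / ((2 : ℝ) ^ k * (Nat.factorial k : ℝ))) *
      (Polynomial.derivative^[k] ((Polynomial.X ^ 2 - 1 : Polynomial ℝ) ^ k)).eval y := by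
    intro y
    have h := aux_W_iter ((Polynomial.X ^ 2 - 1 : Polynomial ℝ) ^ k) k
    simp only [Polynomial.eval_pow, Polynomial.eval_sub, Polynomial.eval_X,
      Polynomial.eval_one] at h
    rw [legendreP, h]
  have eq : ∀ y : ℝ, (y₁ - y₀) / 2 * y + (y₀ + y₁) / 2 = ((y₁ - y₀) * y + y₀ + y₁) / 2 :=
    fun y => by ring
  simp only [eq, zero_add, iteratedDeriv_one] at hibp
  have hl : ∀ A B C : ℝ, A * (B * C) = B * (A * C) := fun A B C => by ring
  simp only [hL, hl]
  rw [intervalIntegral.integral_const_mul, hibp]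
  simp only [← hinner]
  rw [intervalIntegral.integral_const_mul]
  have hf : (Nat.factorial k : ℝ) ≠ 0 := by positivity
  rw [neg_pow]
  field_simp
  ring
end
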